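/- Let ω ⊂ ℝ² be a bounded, connected, open set, let r₀ ≥ 1 and r_f ≥ 1 with r := r_f/r₀ > 1, set λ := r − 1, and let μ > 0, τ > 0, m > 0. Let φ : ℝ² → ℝ be continuously differentiable with Lipschitz-continuous gradient, with sup_{ℝ²} |∇φ|² < λ, and with support contained in r^{−1/6}·ω_m, where ω_m := { x̃ ∈ ω : dist(x̃, ∂ω) > m }. Define the lifted surface y(x̃) := r^{−1/6}(x₁, x₂, 0) + φ(r^{−1/6} x̃) e₃ and the director n₀(x̃) := λ^{−1/2}( ∂₁φ(r^{−1/6}x̃), ∂₂φ(r^{−1/6}x̃), (λ − |∇φ(r^{−1/6}x̃)|²)^{1/2} ). Then there exist constants C > 0 and h₀ > 0 such that for every h ∈ (0, h₀) there are maps y^h : ℝ² → ℝ³, three times continuously differentiable on an open neighborhood of the closure of ω, and Y^h : ℝ³ → ℝ³, continuously differentiable on an open neighborhood of the closure of Ω_h := ω × (−h/2, h/2), with: (i) Y^h(x̃, 0) = y^h(x̃) for all x̃ ∈ ω; (ii) sup_{ω}( |y^h − y| + |∇̃y^h − ∇̃y| ) ≤ Ch; (iii) det ∇Y^h = 1 on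 Ω_h; and (iv) for every measurable N₀^h : Ω_h → ℝ³ with |N₀^h| = 1 a.e. and ess sup_{Ω_h}|N₀^h − n₀| ≤ τh, ∫_{Ω_h} W^e( ∇Y^h, (∇Y^h)N₀^h / |(∇Y^h)N₀^h|, N₀^h ) dx ≤ C h³. -/

import Mathlib

open Matrix MeasureTheory

noncomputable section

/-- Squared Frobenius norm of a matrix. -/
def frob2 {m n : Type*} [Fintype m] [Fintype n] (A : Matrix m n ℝ) : ℝ :=
  ∑ i, ∑ j, (A i j) ^ 2

/-- `v` is a unit vector in `ℝ³`. -/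
def unit3 (v : Fin 3 → ℝ) : Prop := ∑ i, (v i) ^ 2 = 1

/-- Outer product `u ⊗ v` of vectors in `ℝ³`. -/
def outer3 (u v : Fin 3 → ℝ) : Matrix (Fin 3) (Fin 3) ℝ := Matrix.of fun i j => u i * v j

/-- Step-length tensor `ℓ_ν = r^{-1/3}(I₃ + (r-1) ν ⊗ ν)`. -/
def ell (r : ℝ) (v : Fin 3 → ℝ) : Matrix (Fin 3) (Fin 3) ℝ :=
  r ^ (-(1/3) : ℝ) • (1 + (r - 1) • outer3 v v)

/-- Entropic energy density (finite branch). -/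
def We (μ rf r0 : ℝ) (F : Matrix (Fin 3) (Fin 3) ℝ) (ν ν₀ : Fin 3 → ℝ) : ℝ :=
  μ / 2 * (Matrix.trace (Fᵀ * (ell rf ν)⁻¹ * F * ell r0 ν₀) - 3)

/-- Normalization `v / |v|` of a vector in `ℝ³`. -/
def nvec (v : Fin 3 → ℝ) : Fin 3 → ℝ := fun i => v i / Real.sqrt (∑ j, (v j) ^ 2)

/-- Planar Jacobian `∇̃y = (∂₁y | ∂₂y) ∈ ℝ^{3×2}` of a map `y : ℝ² → ℝ³`. -/
def jac32 (y : (Fin 2 → ℝ) → Fin 3 → ℝ) (x : Fin 2 → ℝ) : Matrix (Fin 3) (Fin 2) ℝ :=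
  Matrix.of fun i j => fderiv ℝ y x (Pi.single j 1) i

/-- Full Jacobian `∇Y ∈ ℝ^{3×3}` of a map `Y : ℝ³ → ℝ³`. -/
def jac3 (Y : (Fin 3 → ℝ) → Fin 3 → ℝ) (x : Fin 3 → ℝ) : Matrix (Fin 3) (Fin 3) ℝ :=
  Matrix.of fun i j => fderiv ℝ Y x (Pi.single j 1) i

/-- Gradient of a scalar function on `ℝ²`. -/
def grad2 (φ : (Fin 2 → ℝ) → ℝ) (x : Fin 2 → ℝ) : Fin 2 → ℝ :=
  fun j => fderiv ℝ φ x (Pi.single j 1)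

/-- Planar projection `(x₁, x₂)` of a point `x ∈ ℝ³`. -/
def proj2 (x : Fin 3 → ℝ) : Fin 2 → ℝ := fun j => x j.castSucc

/-- The point `(xt, c) ∈ ℝ³`. -/
def emb (xt : Fin 2 → ℝ) (c : ℝ) : Fin 3 → ℝ :=
  fun i => if h : (i : ℕ) < 2 then xt ⟨i, h⟩ else c

/-- The thin sheet `Ω_h = ω × (-h/2, h/2)`. -/
def slab (ω : Set (Fin 2 → ℝ)) (h : ℝ) : Set (Fin 3 → ℝ) :=
  {x | proj2 x ∈ ω ∧ x 2 ∈ Set.Ioo (-(h / 2)) (h / 2)}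

open scoped Convolution Topology

/-- A map that is `C¹` at the points of a compact set is uniformly Lipschitz near that set. -/
theorem lipschitz_near_compact {E F : Type*} [NormedAddCommGroup E] [NormedSpace ℝ E]
    [NormedAddCommGroup F] [NormedSpace ℝ F] {f : E → F} {S : Set E} (hS : IsCompact S)
    (hf : ∀ a ∈ S, ContDiffAt ℝ 1 f a) :
    ∃ δ > 0, ∃ L > 0, ∀ a ∈ S, ∀ b, dist b a < δ → dist (f b) (f a) ≤ L * dist b a := by
  refine hS.induction_on (p := fun s => ∃ δ > 0, ∃ L > 0, ∀ a ∈ s, ∀ b, dist b a < δ →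
    dist (f b) (f a) ≤ L * dist b a) ⟨1, one_pos, 1, one_pos, by simp⟩ ?_ ?_ ?_
  · rintro s t hst ⟨δ, hδ, L, hL, H⟩
    exact ⟨δ, hδ, L, hL, fun a ha => H a (hst ha)⟩
  · rintro s t ⟨δ, hδ, L, hL, H⟩ ⟨δ', hδ', L', hL', H'⟩
    refine ⟨min δ δ', lt_min hδ hδ', max L L', lt_max_of_lt_left hL, ?_⟩
    rintro a (ha | ha) b hb
    · exact (H a ha b (hb.trans_le (min_le_left _ _))).trans (by gcongr; exact le_max_left _ _)
    · exact (H' a ha b (hb.trans_le (min_le_right _ _))).trans (by gcongr; exact le_max_right _ _)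
  · intro a ha
    obtain ⟨L, t, ht, hLt⟩ := (hf a ha).exists_lipschitzOnWith
    obtain ⟨ε, hε, hεt⟩ := Metric.mem_nhds_iff.1 ht
    refine ⟨_, mem_nhdsWithin_of_mem_nhds (Metric.ball_mem_nhds a (half_pos hε)),
      ε / 2, half_pos hε, L + 1, by positivity, ?_⟩
    intro x hx b hb
    have hxa : dist x a < ε / 2 := hx
    have h1 : x ∈ t := hεt (by simpa using hxa.trans (half_lt_self hε))
    have h2 : b ∈ t := hεt (by
      have := dist_triangle b x a
      simp only [Metric.mem_ball]; linarith)
    refine (hLt.dist_le_mul b h2 x h1).trans ?_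
    gcongr
    linarith

/-- A map that is `C¹` at the points of a compact set is Lipschitz on that set. -/
theorem exists_lipschitzOnWith_of_isCompact {E F : Type*} [NormedAddCommGroup E] [NormedSpace ℝ E]
    [NormedAddCommGroup F] [NormedSpace ℝ F] {f : E → F} {S : Set E} (hS : IsCompact S)
    (hf : ∀ a ∈ S, ContDiffAt ℝ 1 f a) : ∃ K : NNReal, LipschitzOnWith K f S := by
  obtain ⟨δ, hδ, L, hL, H⟩ := lipschitz_near_compact hS hf
  have hc : ContinuousOn f S := fun a ha => (hf a ha).continuousAt.continuousWithinAt
  obtain ⟨B, hB⟩ := (hS.image_of_continuousOn hc).isBounded.exists_norm_le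
  have hB0 : ∀ a ∈ S, ‖f a‖ ≤ B := fun a ha => hB _ ⟨a, ha, rfl⟩
  refine ⟨Real.toNNReal (L + 2 * |B| / δ), LipschitzOnWith.of_dist_le_mul fun x hx z hz => ?_⟩
  rw [Real.coe_toNNReal _ (by positivity)]
  rcases lt_or_ge (dist x z) δ with h | h
  · refine (H z hz x h).trans ?_
    gcongr
    simp only [le_add_iff_nonneg_right]; positivity
  · have h1 : dist (f x) (f z) ≤ 2 * |B| := by
      have := dist_le_norm_add_norm (f x) (f z)
      linarith [hB0 x hx, hB0 z hz, le_abs_self B]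
    have h2 : 2 * |B| ≤ 2 * |B| / δ * dist x z := by
      rw [div_mul_eq_mul_div, le_div_iff₀ hδ]; gcongr
    nlinarith [dist_nonneg (x := x) (y := z)]

/-- Convolution with a fixed compactly supported kernel preserves Lipschitz functions. -/
theorem exists_lipschitz_convolution {k : (Fin 2 → ℝ) → ℝ} (hk : Continuous k)
    (hkc : HasCompactSupport k) :
    ∃ N : NNReal, ∀ (f : (Fin 2 → ℝ) → ℝ) (K : NNReal), LipschitzWith K f →
      LipschitzWith (N * K) (k ⋆[ContinuousLinearMap.lsmul ℝ ℝ, volume] f) := by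
  refine ⟨(∫ t, ‖k t‖).toNNReal, fun f K hf => LipschitzWith.of_dist_le_mul fun x z => ?_⟩
  have hi : ∀ x : Fin 2 → ℝ, Integrable (fun t => k t * f (x - t)) := fun x =>
    (hk.mul (hf.continuous.comp (by fun_prop))).integrable_of_hasCompactSupport hkc.mul_right
  have hki : Integrable k := hk.integrable_of_hasCompactSupport hkc
  rw [convolution_def, convolution_def, dist_eq_norm]
  simp only [ContinuousLinearMap.lsmul_apply, smul_eq_mul]
  rw [← integral_sub (hi x) (hi z)]
  calc ‖∫ t, (k t * f (x - t) - k t * f (z - t))‖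
      ≤ ∫ t, ‖k t‖ * (K * dist x z) := by
        refine norm_integral_le_of_norm_le (hki.norm.mul_const _) (Filter.Eventually.of_forall ?_)
        intro t
        rw [← mul_sub, norm_mul]
        gcongr
        have := hf.dist_le_mul (x - t) (z - t)
        rwa [dist_eq_norm, dist_sub_right] at this
    _ = _ := by
        rw [integral_mul_const, NNReal.coe_mul, Real.coe_toNNReal _ (by positivity)]
        ring

theorem convolution_lsmul_comm (f g : (Fin 2 → ℝ) → ℝ) :
    (f ⋆[ContinuousLinearMap.lsmul ℝ ℝ, volume] g) =
      (g ⋆[ContinuousLinearMap.lsmul ℝ ℝ, volume] f) := by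
  have : (ContinuousLinearMap.lsmul ℝ ℝ : ℝ →L[ℝ] ℝ →L[ℝ] ℝ).flip =
      ContinuousLinearMap.lsmul ℝ ℝ := by ext; simp
  rw [← convolution_flip, this]

theorem LipschitzWith.comp_smul {E F : Type*} [NormedAddCommGroup E] [NormedSpace ℝ E]
    [NormedAddCommGroup F] {f : E → F} {K : NNReal} (hf : LipschitzWith K f) (h : NNReal) :
    LipschitzWith (K * h) (fun z => f ((h : ℝ) • z)) := by
  refine hf.comp (LipschitzWith.of_dist_le_mul fun x z => ?_)
  rw [dist_smul₀]; simp

/-- Derivative of a function precomposed with a dilation. -/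
theorem fderiv_comp_dilation {E F : Type*} [NormedAddCommGroup E] [NormedSpace ℝ E]
    [NormedAddCommGroup F] [NormedSpace ℝ F] {f : E → F} {a : ℝ} {x : E}
    (hf : DifferentiableAt ℝ f (a • x)) (e : E) :
    fderiv ℝ (fun z => f (a • z)) x e = a • fderiv ℝ f (a • x) e := by
  have h1 : HasFDerivAt (fun z : E => a • z) (a • ContinuousLinearMap.id ℝ E) x :=
    (hasFDerivAt_id x).const_smul a
  have h2 : HasFDerivAt (fun z => f (a • z)) _ x := hf.hasFDerivAt.comp x h1
  rw [h2.fderiv]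
  simp

/-- The fixed mollifying kernel. -/
def moll : (Fin 2 → ℝ) → ℝ :=
  (⟨1, 2, one_pos, one_lt_two⟩ : ContDiffBump (0 : Fin 2 → ℝ)).normed volume

theorem contDiff_moll {n : ℕ∞} : ContDiff ℝ n moll := ContDiffBump.contDiff_normed _

theorem hasCompactSupport_moll : HasCompactSupport moll := ContDiffBump.hasCompactSupport_normed _

theorem dist_moll_convolution_le {f : (Fin 2 → ℝ) → ℝ} {K : NNReal} (hf : LipschitzWith K f)
    (x : Fin 2 → ℝ) :
    |(moll ⋆[ContinuousLinearMap.lsmul ℝ ℝ, volume] f) x - f x| ≤ 2 * K := by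
  rw [← Real.dist_eq]
  refine ContDiffBump.dist_normed_convolution_le hf.continuous.aestronglyMeasurable ?_
  intro z hz
  refine (hf.dist_le_mul z x).trans ?_
  have : dist z x < 2 := hz
  nlinarith [K.2]

/-- Mollification of a Lipschitz function at scale `h`, with control of two derivatives. -/
theorem exists_mollification_lipschitz {f : (Fin 2 → ℝ) → ℝ} {K : NNReal}
    (hf : LipschitzWith K f) :
    ∃ M : ℝ, 0 < M ∧ ∀ h : ℝ, 0 < h → ∃ g : (Fin 2 → ℝ) → ℝ, ContDiff ℝ 3 g ∧
      (∀ x, |g x - f x| ≤ M * h) ∧ (∀ x, ‖fderiv ℝ g x‖ ≤ M) ∧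
      ∀ i x, ‖fderiv ℝ (fun z => fderiv ℝ g z (Pi.single i 1)) x‖ ≤ M / h := by
  have hd : ∀ i : Fin 2, ContDiff ℝ 3 (fun z => fderiv ℝ moll z (Pi.single i 1)) := fun i =>
    ((contDiff_moll (n := 4)).fderiv_right (m := 3) (by norm_num)).clm_apply contDiff_const
  have hdc : ∀ i : Fin 2, HasCompactSupport (fun z => fderiv ℝ moll z (Pi.single i 1)) := fun i =>
    hasCompactSupport_moll.fderiv_apply ℝ _
  obtain ⟨N, hN⟩ := exists_lipschitz_convolution (contDiff_moll (n := 0)).continuous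
    hasCompactSupport_moll
  choose D hD using fun i => exists_lipschitz_convolution (hd i).continuous (hdc i)
  refine ⟨2 * K + N * K + D 0 * K + D 1 * K + 1, by positivity, fun h hh => ?_⟩
  lift h to NNReal using hh.le
  have hhn : (h : ℝ) ≠ 0 := hh.ne'
  have hhn' : h ≠ 0 := by exact_mod_cast hhn
  set F : (Fin 2 → ℝ) → ℝ := fun z => f ((h : ℝ) • z) with hF
  have hFl : LipschitzWith (K * h) F := hf.comp_smul h
  set u := moll ⋆[ContinuousLinearMap.lsmul ℝ ℝ, volume] F with hu
  have huc : ContDiff ℝ 3 u := hasCompactSupport_moll.contDiff_convolution_left (n := 3) _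
    contDiff_moll hFl.continuous.locallyIntegrable
  have hud : ∀ (i : Fin 2) z, fderiv ℝ u z (Pi.single i 1) =
      ((fun z => fderiv ℝ moll z (Pi.single i 1)) ⋆[ContinuousLinearMap.lsmul ℝ ℝ, volume] F) z := by
    intro i z
    rw [hu, convolution_lsmul_comm, (hasCompactSupport_moll.hasFDerivAt_convolution_right _
      hFl.continuous.locallyIntegrable contDiff_moll z).fderiv,
      convolution_precompR_apply _ hFl.continuous.locallyIntegrable
        (hasCompactSupport_moll.fderiv ℝ)
        ((contDiff_moll (n := 1)).continuous_fderiv one_ne_zero), convolution_lsmul_comm]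
  have hgl : LipschitzWith (N * (K * h) * h⁻¹) (fun x => u ((h : ℝ)⁻¹ • x)) := by
    simpa using (hN F _ hFl).comp_smul h⁻¹
  refine ⟨fun x => u ((h : ℝ)⁻¹ • x), huc.comp (contDiff_const_smul _), ?_, ?_, ?_⟩
  · intro x
    have := dist_moll_convolution_le hFl ((h : ℝ)⁻¹ • x)
    simp only [hF, smul_smul, mul_inv_cancel₀ hhn, one_smul] at this
    refine this.trans ?_
    push_cast
    have : (0 : ℝ) ≤ (N * K + D 0 * K + D 1 * K + 1) * h := by positivity
    linarith
  · intro x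
    refine (norm_fderiv_le_of_lipschitz ℝ hgl).trans ?_
    have : N * (K * h) * h⁻¹ = N * K := by field_simp
    rw [this]; push_cast
    have : (0 : ℝ) ≤ (2 * K + D 0 * K + D 1 * K + 1) := by positivity
    linarith
  · intro i x
    have e : (fun z => fderiv ℝ (fun x => u ((h : ℝ)⁻¹ • x)) z (Pi.single i 1)) = fun z =>
        (h : ℝ)⁻¹ • ((fun z => fderiv ℝ moll z (Pi.single i 1))
          ⋆[ContinuousLinearMap.lsmul ℝ ℝ, volume] F) (((h⁻¹ : NNReal) : ℝ) • z) := by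
      ext z
      rw [fderiv_comp_dilation (huc.differentiable (by norm_num)).differentiableAt, hud]
      simp
    rw [e]
    have hl := ((lipschitzWith_smul ((h : ℝ)⁻¹)).comp ((hD i F _ hFl).comp_smul h⁻¹))
    refine (norm_fderiv_le_of_lipschitz ℝ hl).trans ?_
    have : ‖(h : ℝ)⁻¹‖₊ * (D i * (K * h) * h⁻¹) = D i * K * h⁻¹ := by
      have : ‖(h : ℝ)⁻¹‖₊ = h⁻¹ := by ext; simp
      rw [this]; field_simp
    rw [this]; push_cast
    rw [div_eq_mul_inv]
    gcongr
    have : (0 : ℝ) ≤ 2 * K + N * K := by positivity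
    have h0 : (0 : ℝ) ≤ D 0 * K := by positivity
    have h1 : (0 : ℝ) ≤ D 1 * K := by positivity
    fin_cases i <;> simp <;> linarith

/-- Mollification at scale `h` of a compactly supported `C¹` function with Lipschitz gradient. -/
theorem exists_mollification_C11 {f : (Fin 2 → ℝ) → ℝ} {K : NNReal}
    (hf : ContDiff ℝ 1 f) (hfc : HasCompactSupport f) (hl : LipschitzWith K (grad2 f)) :
    ∃ M : ℝ, 0 < M ∧ ∀ h : ℝ, 0 < h → ∃ g : (Fin 2 → ℝ) → ℝ, ContDiff ℝ 3 g ∧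
      (∀ x, |g x - f x| ≤ M * h) ∧ ∀ x i, |grad2 g x i - grad2 f x i| ≤ M * h := by
  obtain ⟨K', hK'⟩ := hf.lipschitzWith_of_hasCompactSupport hfc one_ne_zero
  refine ⟨2 * K + 2 * K' + 1, by positivity, fun h hh => ?_⟩
  lift h to NNReal using hh.le
  have hhn : (h : ℝ) ≠ 0 := hh.ne'
  set F : (Fin 2 → ℝ) → ℝ := fun z => f ((h : ℝ) • z) with hF
  have hFl : LipschitzWith (K' * h) F := hK'.comp_smul h
  have hFs : ContDiff ℝ 1 F := hf.comp (contDiff_const_smul _)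
  have hFc : HasCompactSupport F := hfc.comp_smul hhn
  set u := moll ⋆[ContinuousLinearMap.lsmul ℝ ℝ, volume] F with hu
  have huc : ContDiff ℝ 3 u := hasCompactSupport_moll.contDiff_convolution_left (n := 3) _
    contDiff_moll hFl.continuous.locallyIntegrable
  have hml : LocallyIntegrable moll volume :=
    (contDiff_moll (n := 0)).continuous.locallyIntegrable
  have hud : ∀ (i : Fin 2) z, fderiv ℝ u z (Pi.single i 1) =
      (moll ⋆[ContinuousLinearMap.lsmul ℝ ℝ, volume] fun z => fderiv ℝ F z (Pi.single i 1)) z := by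
    intro i z
    rw [hu, (hFc.hasFDerivAt_convolution_right _ hml hFs z).fderiv,
      convolution_precompR_apply _ hml (hFc.fderiv ℝ) (hFs.continuous_fderiv one_ne_zero)]
  have hli : ∀ i : Fin 2, LipschitzWith K (fun z => grad2 f z i) := fun i =>
    LipschitzWith.of_dist_le_mul fun x z => (dist_le_pi_dist _ _ i).trans (hl.dist_le_mul x z)
  refine ⟨fun x => u ((h : ℝ)⁻¹ • x), huc.comp (contDiff_const_smul _), ?_, ?_⟩
  · intro x
    have := dist_moll_convolution_le hFl ((h : ℝ)⁻¹ • x)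
    simp only [hF, smul_smul, mul_inv_cancel₀ hhn, one_smul] at this
    refine this.trans ?_
    push_cast
    have : (0 : ℝ) ≤ (2 * K + 1) * h := by positivity
    linarith
  · intro x i
    have e : (fun z => fderiv ℝ F z (Pi.single i 1)) =
        fun z => (h : ℝ) • grad2 f ((h : ℝ) • z) i := by
      ext z
      rw [hF, fderiv_comp_dilation (hf.differentiable one_ne_zero).differentiableAt]
      rfl
    have hl2 : LipschitzWith (h * (K * h)) (fun z => fderiv ℝ F z (Pi.single i 1)) := by
      rw [e]
      have h3 := (lipschitzWith_smul (β := ℝ) (h : ℝ)).comp ((hli i).comp_smul h)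
      have : ‖(h : ℝ)‖₊ = h := by ext; simp
      rwa [this] at h3
    have := dist_moll_convolution_le hl2 ((h : ℝ)⁻¹ • x)
    rw [← hud, congrFun e] at this
    simp only [smul_smul, mul_inv_cancel₀ hhn, one_smul] at this
    rw [grad2, fderiv_comp_dilation (huc.differentiable (by norm_num)).differentiableAt]
    have e2 : (h : ℝ)⁻¹ • fderiv ℝ u ((h : ℝ)⁻¹ • x) (Pi.single i 1) - grad2 f x i =
        (h : ℝ)⁻¹ * (fderiv ℝ u ((h : ℝ)⁻¹ • x) (Pi.single i 1) - (h : ℝ) • grad2 f x i) := by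
      simp only [smul_eq_mul]; field_simp
    rw [e2, abs_mul, abs_of_pos (inv_pos.2 hh)]
    have h4 : (h : ℝ)⁻¹ * (2 * ((h * (K * h) : NNReal) : ℝ)) = 2 * K * h := by
      push_cast; field_simp
    have h5 : (0 : ℝ) ≤ (2 * K' + 1) * h := by positivity
    have h6 := mul_le_mul_of_nonneg_left this (inv_pos.2 hh).le
    rw [h4] at h6
    linarith

/-- The planar projection as a continuous linear map. -/
def proj2L : (Fin 3 → ℝ) →L[ℝ] (Fin 2 → ℝ) :=
  ContinuousLinearMap.pi fun j => ContinuousLinearMap.proj j.castSucc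

theorem proj2L_apply (x : Fin 3 → ℝ) : proj2L x = proj2 x := rfl

theorem norm_proj2_le (x : Fin 3 → ℝ) : ‖proj2 x‖ ≤ ‖x‖ :=
  (pi_norm_le_iff_of_nonneg (norm_nonneg x)).2 fun _ => norm_le_pi_norm x _

theorem norm_single_one {n : ℕ} (i : Fin n) : ‖(Pi.single i 1 : Fin n → ℝ)‖ = 1 := by
  rw [Pi.norm_single, norm_one]

theorem abs_apply_le_of_norm_le {E : Type*} [NormedAddCommGroup E] [NormedSpace ℝ E]
    {A : E →L[ℝ] ℝ} {B : ℝ} (hA : ‖A‖ ≤ B) {e : E} (he : ‖e‖ ≤ 1) : |A e| ≤ B := by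
  have := A.le_opNorm e
  have h := mul_le_mul_of_nonneg_left he (norm_nonneg A)
  rw [mul_one] at h
  exact this.trans (h.trans hA)

theorem dist_proj2_le (x z : Fin 3 → ℝ) : dist (proj2 x) (proj2 z) ≤ dist x z := by
  rw [dist_eq_norm, dist_eq_norm]; exact norm_proj2_le (x - z)

theorem jac3_comp {f g : (Fin 3 → ℝ) → Fin 3 → ℝ} {x : Fin 3 → ℝ}
    (hf : DifferentiableAt ℝ f (g x)) (hg : DifferentiableAt ℝ g x) :
    jac3 (fun z => f (g z)) x = jac3 f (g x) * jac3 g x := by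
  have h : fderiv ℝ (fun z => f (g z)) x = (fderiv ℝ f (g x)).comp (fderiv ℝ g x) :=
    fderiv_comp x hf hg
  have := LinearMap.toMatrix'_comp (fderiv ℝ f (g x) : (Fin 3 → ℝ) →ₗ[ℝ] Fin 3 → ℝ)
    (fderiv ℝ g x : (Fin 3 → ℝ) →ₗ[ℝ] Fin 3 → ℝ)
  rw [show jac3 (fun z => f (g z)) x = LinearMap.toMatrix'
    (fderiv ℝ (fun z => f (g z)) x : (Fin 3 → ℝ) →ₗ[ℝ] Fin 3 → ℝ) from rfl, h]
  exact this

/-- The root `ξ` of `ξ + p ξ² / 2 = t` that vanishes with `t`. -/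
def quadRoot (p t : ℝ) : ℝ := 2 * t / (1 + √(1 + 2 * p * t))

theorem quadRoot_zero (p : ℝ) : quadRoot p 0 = 0 := by simp [quadRoot]

theorem abs_quadRoot_le (p t : ℝ) : |quadRoot p t| ≤ 2 * |t| := by
  have h := Real.sqrt_nonneg (1 + 2 * p * t)
  rw [quadRoot, abs_div, abs_mul, abs_two, abs_of_pos (by linarith : (0:ℝ) < 1 + √(1 + 2 * p * t))]
  exact div_le_self (by positivity) (by linarith)

theorem quadRoot_spec {p t : ℝ} (h : 0 ≤ 1 + 2 * p * t) :
    quadRoot p t + p * quadRoot p t ^ 2 / 2 = t := by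
  have h0 := Real.sqrt_nonneg (1 + 2 * p * t)
  have h1 := Real.sq_sqrt h
  unfold quadRoot
  set u := √(1 + 2 * p * t)
  have : 1 + u ≠ 0 := by positivity
  field_simp
  linear_combination -t * h1

/-- The defining function of the vertical rescaling attached to a shear in direction `i`. -/
def shearHeight (i : Fin 2) (v : (Fin 2 → ℝ) → ℝ) (x : Fin 3 → ℝ) : ℝ :=
  quadRoot (fderiv ℝ v (proj2 x) (Pi.single i 1)) (x 2)

/-- A volume preserving map that fixes the plane `x₃ = 0` and shears it in direction `i`. -/
def shear (i : Fin 2) (v : (Fin 2 → ℝ) → ℝ) (x : Fin 3 → ℝ) : Fin 3 → ℝ :=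
  x + (shearHeight i v x * v (proj2 x)) • (Pi.single i.castSucc 1 : Fin 3 → ℝ)
    + (shearHeight i v x - x 2) • (Pi.single 2 1 : Fin 3 → ℝ)

/-- Jacobian of a shear at the fixed plane. -/
def shearJac (i : Fin 2) (a : ℝ) : Matrix (Fin 3) (Fin 3) ℝ := 1 + Matrix.single i.castSucc 2 a

theorem shear_plane (i : Fin 2) (v : (Fin 2 → ℝ) → ℝ) {x : Fin 3 → ℝ} (hx : x 2 = 0) :
    shear i v x = x := by simp [shear, shearHeight, hx, quadRoot_zero]

theorem shear_two (i : Fin 2) (v : (Fin 2 → ℝ) → ℝ) (x : Fin 3 → ℝ) :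
    shear i v x 2 = shearHeight i v x := by
  fin_cases i <;> simp [shear]

theorem castSucc_ne_two (i : Fin 2) : i.castSucc ≠ (2 : Fin 3) := by fin_cases i <;> decide

section
variable {i : Fin 2} {v : (Fin 2 → ℝ) → ℝ} {M : ℝ} {x : Fin 3 → ℝ}

theorem shear_radicand_pos (hv' : ∀ z, ‖fderiv ℝ v z‖ ≤ M) (hx : M * |x 2| ≤ 1 / 8) :
    3 / 4 ≤ 1 + 2 * fderiv ℝ v (proj2 x) (Pi.single i 1) * x 2 := by
  have h1 : |fderiv ℝ v (proj2 x) (Pi.single i 1)| ≤ M :=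
    abs_apply_le_of_norm_le (hv' _) (norm_single_one i).le
  have h2 : |fderiv ℝ v (proj2 x) (Pi.single i 1) * x 2| ≤ 1 / 8 := by
    rw [abs_mul]; exact (mul_le_mul_of_nonneg_right h1 (abs_nonneg _)).trans hx
  have := (abs_le.1 h2).1
  linarith

theorem contDiffAt_shearHeight (hv : ContDiff ℝ 3 v)
    (hv' : ∀ z, ‖fderiv ℝ v z‖ ≤ M) (hx : M * |x 2| ≤ 1 / 8) :
    ContDiffAt ℝ 1 (shearHeight i v) x := by
  have hpos := shear_radicand_pos (i := i) hv' hx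
  have hpr : ContDiff ℝ 1 (fun x : Fin 3 → ℝ => proj2 x) := proj2L.contDiff
  have hp : ContDiff ℝ 1 (fun x : Fin 3 → ℝ => fderiv ℝ v (proj2 x) (Pi.single i 1)) :=
    ((hv.fderiv_right (m := 1) (by norm_num)).comp hpr).clm_apply contDiff_const
  have h2 : ContDiff ℝ 1 (fun x : Fin 3 → ℝ => x 2) := contDiff_apply ℝ ℝ 2
  have hr : ContDiffAt ℝ 1 (fun x : Fin 3 → ℝ =>
      √(1 + 2 * fderiv ℝ v (proj2 x) (Pi.single i 1) * x 2)) x :=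
    (contDiff_const.add ((contDiff_const.mul hp).mul h2)).contDiffAt.sqrt (by linarith)
  exact (contDiff_const.mul h2).contDiffAt.div (contDiffAt_const.add hr) (by positivity)

theorem contDiffAt_shear (hv : ContDiff ℝ 3 v)
    (hv' : ∀ z, ‖fderiv ℝ v z‖ ≤ M) (hx : M * |x 2| ≤ 1 / 8) :
    ContDiffAt ℝ 1 (shear i v) x := by
  have hpr : ContDiff ℝ 1 (fun x : Fin 3 → ℝ => proj2 x) := proj2L.contDiff
  have h2 : ContDiff ℝ 1 (fun x : Fin 3 → ℝ => x 2) := contDiff_apply ℝ ℝ 2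
  have hh := contDiffAt_shearHeight (i := i) hv hv' hx
  exact (contDiffAt_id.add ((hh.mul ((hv.of_le (by norm_num)).comp hpr).contDiffAt).smul
    contDiffAt_const)).add ((hh.sub h2.contDiffAt).smul contDiffAt_const)

/-- The derivative of `shearHeight`, from implicit differentiation. -/
theorem fderiv_shearHeight (hv : ContDiff ℝ 3 v)
    (hv' : ∀ z, ‖fderiv ℝ v z‖ ≤ M) (hx : M * |x 2| ≤ 1 / 8) (e : Fin 3 → ℝ) :
    fderiv ℝ (shearHeight i v) x e *
        (1 + fderiv ℝ v (proj2 x) (Pi.single i 1) * shearHeight i v x) +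
      fderiv ℝ (fun z => fderiv ℝ v z (Pi.single i 1)) (proj2 x) (proj2 e) *
        shearHeight i v x ^ 2 / 2 = e 2 := by
  have hh := ((contDiffAt_shearHeight (i := i) hv hv' hx).differentiableAt
    one_ne_zero).hasFDerivAt
  have hp : DifferentiableAt ℝ (fun z => fderiv ℝ v z (Pi.single i 1)) (proj2 x) :=
    (((hv.fderiv_right (m := 1) (by norm_num)).clm_apply contDiff_const).differentiable
      one_ne_zero).differentiableAt
  have hpd : HasFDerivAt (fun x : Fin 3 → ℝ => fderiv ℝ v (proj2 x) (Pi.single i 1))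
      ((fderiv ℝ (fun z => fderiv ℝ v z (Pi.single i 1)) (proj2 x)).comp proj2L) x :=
    hp.hasFDerivAt.comp x proj2L.hasFDerivAt
  have hL := hh.add ((hpd.mul (hh.pow 2)).mul_const (1 / 2))
  have hR : HasFDerivAt (fun x : Fin 3 → ℝ => x 2)
    (ContinuousLinearMap.proj (R := ℝ) (φ := fun _ : Fin 3 => ℝ) 2) x := hasFDerivAt_apply 2 x
  have hnear : ∀ᶠ z : Fin 3 → ℝ in 𝓝 x,
      0 < 1 + 2 * fderiv ℝ v (proj2 z) (Pi.single i 1) * z 2 := by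
    have hc : ContinuousAt (fun z : Fin 3 → ℝ =>
        1 + 2 * fderiv ℝ v (proj2 z) (Pi.single i 1) * z 2) x :=
      continuousAt_const.add ((continuousAt_const.mul hpd.continuousAt).mul hR.continuousAt)
    exact hc.eventually_const_lt (by linarith [shear_radicand_pos (i := i) hv' hx])
  have heq : (fun x : Fin 3 → ℝ => x 2) =ᶠ[𝓝 x]
      (shearHeight i v + (fun x => fderiv ℝ v (proj2 x) (Pi.single i 1)) * shearHeight i v ^ 2 *
        fun _ => 1 / 2) := by
    filter_upwards [hnear] with z hz
    have := quadRoot_spec hz.le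
    simp only [Pi.add_apply, Pi.mul_apply, Pi.pow_apply, shearHeight]
    linarith
  have hu := (hL.congr_of_eventuallyEq heq).unique hR
  have := congrArg (fun A : (Fin 3 → ℝ) →L[ℝ] ℝ => A e) hu
  simp [proj2L_apply] at this
  linarith

theorem jac3_shear (hv : ContDiff ℝ 3 v)
    (hv' : ∀ z, ‖fderiv ℝ v z‖ ≤ M) (hx : M * |x 2| ≤ 1 / 8) (k j : Fin 3) :
    jac3 (shear i v) x k j = (Pi.single j 1 : Fin 3 → ℝ) k +
      (fderiv ℝ (shearHeight i v) x (Pi.single j 1) * v (proj2 x) +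
        shearHeight i v x * fderiv ℝ v (proj2 x) (proj2 (Pi.single j 1))) *
          (Pi.single i.castSucc 1 : Fin 3 → ℝ) k +
      (fderiv ℝ (shearHeight i v) x (Pi.single j 1) - (Pi.single j 1 : Fin 3 → ℝ) 2) *
        (Pi.single 2 1 : Fin 3 → ℝ) k := by
  have hh := ((contDiffAt_shearHeight (i := i) hv hv' hx).differentiableAt
    one_ne_zero).hasFDerivAt
  have hvd : HasFDerivAt (fun x : Fin 3 → ℝ => v (proj2 x))
      ((fderiv ℝ v (proj2 x)).comp proj2L) x :=
    (hv.differentiable (by norm_num)).differentiableAt.hasFDerivAt.comp x proj2L.hasFDerivAt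
  have hR : HasFDerivAt (fun x : Fin 3 → ℝ => x 2)
    (ContinuousLinearMap.proj (R := ℝ) (φ := fun _ : Fin 3 => ℝ) 2) x := hasFDerivAt_apply 2 x
  have h : HasFDerivAt (shear i v) _ x := ((hasFDerivAt_id x).add ((hh.mul hvd).smul_const _)).add
    ((hh.sub hR).smul_const _)
  simp only [jac3, Matrix.of_apply, h.fderiv]
  simp only [_root_.add_apply, ContinuousLinearMap.smulRight_apply,
    _root_.sub_apply, _root_.smul_apply, ContinuousLinearMap.comp_apply,
    ContinuousLinearMap.id_apply, ContinuousLinearMap.proj_apply, proj2L_apply, Pi.add_apply,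
    Pi.smul_apply, smul_eq_mul]
  ring

theorem det_jac3_shear (hv : ContDiff ℝ 3 v)
    (hv' : ∀ z, ‖fderiv ℝ v z‖ ≤ M) (hx : M * |x 2| ≤ 1 / 8) :
    (jac3 (shear i v) x).det = 1 := by
  have h := fderiv_shearHeight (i := i) hv hv' hx (Pi.single 2 1)
  have h2 : proj2 (Pi.single 2 1) = 0 := by ext j; fin_cases j <;> simp [proj2]
  have h0 : proj2 (Pi.single 0 1) = Pi.single 0 1 := by ext j; fin_cases j <;> simp [proj2]
  have h1 : proj2 (Pi.single 1 1) = Pi.single 1 1 := by ext j; fin_cases j <;> simp [proj2]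
  rw [h2] at h
  simp only [map_zero, zero_mul, zero_div, add_zero, Pi.single_eq_same] at h
  simp only [Matrix.det_fin_three, jac3_shear hv hv' hx, h0, h1, h2]
  fin_cases i <;> simp at h ⊢ <;> linear_combination h

theorem abs_jac3_shear_sub_le (hv : ContDiff ℝ 3 v) (hM : 0 < M) (hv0 : ∀ z, |v z| ≤ M)
    (hv' : ∀ z, ‖fderiv ℝ v z‖ ≤ M) {h : ℝ} (hh : 0 < h)
    (hv2 : ∀ z, ‖fderiv ℝ (fun z => fderiv ℝ v z (Pi.single i 1)) z‖ ≤ M / h)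
    (hMh : M * h ≤ 1 / 8) (hx : |x 2| ≤ h) (k j : Fin 3) :
    |jac3 (shear i v) x k j - shearJac i (v (proj2 x)) k j| ≤ (8 * M ^ 2 + 10 * M) * h := by
  have hx' : M * |x 2| ≤ 1 / 8 := (by gcongr : M * |x 2| ≤ M * h).trans hMh
  have e1 := fderiv_shearHeight (i := i) hv hv' hx' (Pi.single j 1)
  have hξ : |shearHeight i v x| ≤ 2 * h := (abs_quadRoot_le _ _).trans (by linarith)
  have hpe : ‖proj2 (Pi.single j 1)‖ ≤ 1 := (norm_proj2_le _).trans (norm_single_one j).le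
  have hp : |fderiv ℝ v (proj2 x) (Pi.single i 1)| ≤ M :=
    abs_apply_le_of_norm_le (hv' _) (norm_single_one i).le
  have hq : |fderiv ℝ (fun z => fderiv ℝ v z (Pi.single i 1)) (proj2 x)
      (proj2 (Pi.single j 1))| ≤ M / h :=
    abs_apply_le_of_norm_le (hv2 _) hpe
  have hw : |fderiv ℝ v (proj2 x) (proj2 (Pi.single j 1))| ≤ M :=
    abs_apply_le_of_norm_le (hv' _) hpe
  have hvx := hv0 (proj2 x)
  have hdl : |(Pi.single j 1 : Fin 3 → ℝ) 2| ≤ 1 := by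
    rw [Pi.single_apply]; split_ifs <;> simp
  have hform := jac3_shear (i := i) hv hv' hx' k j
  set A := fderiv ℝ (shearHeight i v) x (Pi.single j 1)
  set ξ := shearHeight i v x
  set p := fderiv ℝ v (proj2 x) (Pi.single i 1)
  set q := fderiv ℝ (fun z => fderiv ℝ v z (Pi.single i 1)) (proj2 x) (proj2 (Pi.single j 1))
  set w := fderiv ℝ v (proj2 x) (proj2 (Pi.single j 1))
  set V := v (proj2 x)
  set d := (Pi.single j 1 : Fin 3 → ℝ) 2 with hd
  have hpξ : |p * ξ| ≤ 2 * (M * h) := by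
    rw [abs_mul]
    calc |p| * |ξ| ≤ M * (2 * h) := by gcongr
      _ = _ := by ring
  have hqξ : |q * ξ ^ 2 / 2| ≤ 2 * (M * h) := by
    rw [abs_div, abs_mul, abs_pow, abs_two]
    calc |q| * |ξ| ^ 2 / 2 ≤ M / h * (2 * h) ^ 2 / 2 := by gcongr
      _ = _ := by field_simp
  have hAd : |A - d| ≤ 8 * (M * h) := by
    have e2 : (A - d) * (1 + p * ξ) = -(q * ξ ^ 2 / 2) - d * (p * ξ) := by linear_combination e1
    have h3 : |(A - d) * (1 + p * ξ)| ≤ 4 * (M * h) := by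
      rw [e2]
      refine (abs_sub _ _).trans ?_
      rw [abs_neg, abs_mul d]
      have : |d| * |p * ξ| ≤ 1 * |p * ξ| := by gcongr
      linarith
    have h4 : 1 / 2 ≤ 1 + p * ξ := by linarith [(abs_le.1 hpξ).1]
    rw [abs_mul, abs_of_pos (by linarith : 0 < 1 + p * ξ)] at h3
    nlinarith [abs_nonneg (A - d)]
  have hB : |A * V + ξ * w - d * V| ≤ (8 * M ^ 2 + 2 * M) * h := by
    have : A * V + ξ * w - d * V = (A - d) * V + ξ * w := by ring
    rw [this]
    refine (abs_add_le _ _).trans ?_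
    rw [abs_mul, abs_mul]
    calc |A - d| * |V| + |ξ| * |w| ≤ 8 * (M * h) * M + 2 * h * M := by gcongr
      _ = _ := by ring
  have e3 : jac3 (shear i v) x k j - shearJac i V k j =
      (A * V + ξ * w - d * V) * (Pi.single i.castSucc 1 : Fin 3 → ℝ) k +
        (A - d) * (Pi.single 2 1 : Fin 3 → ℝ) k := by
    rw [hform, shearJac, Matrix.add_apply, Matrix.one_apply, Matrix.single_apply, hd]
    simp only [Pi.single_apply]
    have : (i.castSucc = k ∧ 2 = j) ↔ (k = i.castSucc ∧ 2 = j) := by rw [eq_comm]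
    simp only [this]
    have hne := castSucc_ne_two i
    have hne' := hne.symm
    split_ifs <;> simp_all
  rw [e3]
  have hs : ∀ l : Fin 3, |(Pi.single l 1 : Fin 3 → ℝ) k| ≤ 1 := fun l => by
    rw [Pi.single_apply]; split_ifs <;> simp
  refine (abs_add_le _ _).trans ?_
  rw [abs_mul, abs_mul]
  have := mul_le_mul hB (hs i.castSucc) (abs_nonneg _) (by positivity)
  have := mul_le_mul hAd (hs 2) (abs_nonneg _) (by positivity)
  linarith

theorem dist_shear_le (hv0 : ∀ z, |v z| ≤ M) {h : ℝ} (hx : |x 2| ≤ h) :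
    dist (shear i v x) x ≤ (2 * M + 3) * h := by
  have hh : 0 ≤ h := (abs_nonneg _).trans hx
  have hM : 0 ≤ M := (abs_nonneg _).trans (hv0 0)
  have hξ : |shearHeight i v x| ≤ 2 * h := (abs_quadRoot_le _ _).trans (by linarith)
  rw [dist_eq_norm, shear, add_assoc, add_sub_cancel_left]
  refine (norm_add_le _ _).trans ?_
  rw [norm_smul, norm_smul]
  simp only [Pi.norm_single, norm_one, mul_one, Real.norm_eq_abs, abs_mul]
  have h1 : |shearHeight i v x| * |v (proj2 x)| ≤ 2 * h * M := by gcongr; exact hv0 _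
  have h2 := abs_sub (shearHeight i v x) (x 2)
  linarith

end

theorem outer3_mul_self {n : Fin 3 → ℝ} (hn : unit3 n) : outer3 n n * outer3 n n = outer3 n n := by
  ext i j
  simp only [unit3, Fin.sum_univ_three] at hn
  simp only [outer3, Matrix.mul_apply, Matrix.of_apply, Fin.sum_univ_three]
  linear_combination n i * n j * hn

theorem outer3_mulVec (F : Matrix (Fin 3) (Fin 3) ℝ) (n : Fin 3 → ℝ) :
    outer3 (F *ᵥ n) (F *ᵥ n) = F * outer3 n n * Fᵀ := by
  ext i j
  simp only [outer3, Matrix.mul_apply, Matrix.of_apply, Fin.sum_univ_three, Matrix.mulVec,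
    dotProduct, Matrix.transpose_apply]
  ring

theorem det_ell {r : ℝ} (hr : 0 < r) {n : Fin 3 → ℝ} (hn : unit3 n) : (ell r n).det = 1 := by
  have h3 : (r ^ (-(1/3) : ℝ)) ^ 3 * r = 1 := by
    rw [← Real.rpow_natCast, ← Real.rpow_mul hr.le]
    norm_num
    rw [Real.rpow_neg_one, inv_mul_cancel₀ hr.ne']
  simp only [unit3, Fin.sum_univ_three] at hn
  have : (1 + (r - 1) • outer3 n n).det = r := by
    simp [Matrix.det_fin_three, outer3]
    linear_combination (r - 1) * hn
  rw [ell, Matrix.det_smul, this]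
  simpa using h3

theorem ell_inv {r : ℝ} (hr : 0 < r) {n : Fin 3 → ℝ} (hn : unit3 n) :
    (ell r n)⁻¹ = (r ^ (-(1/3) : ℝ))⁻¹ • (1 - (1 - 1 / r) • outer3 n n) := by
  have hc : r ^ (-(1/3) : ℝ) ≠ 0 := (Real.rpow_pos_of_pos hr _).ne'
  refine Matrix.inv_eq_right_inv ?_
  rw [ell, Matrix.smul_mul, Matrix.mul_smul, smul_smul, mul_inv_cancel₀ hc, one_smul]
  simp only [add_mul, mul_sub, one_mul, mul_one, Matrix.smul_mul, Matrix.mul_smul,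
    outer3_mul_self hn]
  match_scalars <;> field_simp
  ring

/-- The relative strain `Fᵀ (ℓᶠ)⁻¹ F ℓ⁰` for the convected director, in explicit form. -/
def relStrain (rf r0 : ℝ) (F : Matrix (Fin 3) (Fin 3) ℝ) (n : Fin 3 → ℝ) :
    Matrix (Fin 3) (Fin 3) ℝ :=
  (r0 ^ (-(1/3) : ℝ) / rf ^ (-(1/3) : ℝ)) •
    (Fᵀ * (1 - ((1 - 1 / rf) / ∑ j, (F *ᵥ n) j ^ 2) • outer3 (F *ᵥ n) (F *ᵥ n)) * F *
      (1 + (r0 - 1) • outer3 n n))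

theorem sum_sq_pos {w : Fin 3 → ℝ} (hw : w ≠ 0) : 0 < ∑ j, w j ^ 2 := by
  obtain ⟨i, hi⟩ := Function.ne_iff.1 hw
  exact Finset.sum_pos' (fun _ _ => sq_nonneg _)
    ⟨i, Finset.mem_univ _, lt_of_le_of_ne (sq_nonneg _) (pow_ne_zero 2 hi).symm⟩

theorem unit3_nvec {w : Fin 3 → ℝ} (hw : w ≠ 0) : unit3 (nvec w) := by
  have h := sum_sq_pos hw
  simp only [unit3, nvec, div_pow, Real.sq_sqrt h.le]
  rw [← Finset.sum_div, div_self h.ne']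

theorem outer3_nvec (w : Fin 3 → ℝ) :
    outer3 (nvec w) (nvec w) = (1 / ∑ j, w j ^ 2) • outer3 w w := by
  ext i j
  have h : 0 ≤ ∑ j, w j ^ 2 := Finset.sum_nonneg fun _ _ => sq_nonneg _
  simp only [outer3, nvec, Matrix.of_apply, Matrix.smul_apply, smul_eq_mul]
  rw [div_mul_div_comm, Real.mul_self_sqrt h]
  ring

section
variable {rf r0 : ℝ} {F : Matrix (Fin 3) (Fin 3) ℝ} {n : Fin 3 → ℝ}

theorem mulVec_ne_zero_of_unit3 (hF : F.det = 1) (hn : unit3 n) : F *ᵥ n ≠ 0 := by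
  intro h
  have := Matrix.eq_zero_of_mulVec_eq_zero (by rw [hF]; exact one_ne_zero) h
  simp [this, unit3] at hn

theorem relStrain_eq (hrf : 0 < rf) (hF : F.det = 1) (hn : unit3 n) :
    Fᵀ * (ell rf (nvec (F *ᵥ n)))⁻¹ * F * ell r0 n = relStrain rf r0 F n := by
  rw [ell_inv hrf (unit3_nvec (mulVec_ne_zero_of_unit3 hF hn)), ell, outer3_nvec, smul_smul,
    relStrain, mul_one_div]
  simp only [Matrix.mul_smul, Matrix.smul_mul, smul_smul]
  rw [div_eq_mul_inv (r0 ^ (-(1/3) : ℝ))]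

theorem det_relStrain (hrf : 0 < rf) (hr0 : 0 < r0) (hF : F.det = 1) (hn : unit3 n) :
    (relStrain rf r0 F n).det = 1 := by
  rw [← relStrain_eq hrf hF hn]
  simp [Matrix.det_mul, Matrix.det_nonsing_inv, det_ell hr0 hn,
    det_ell hrf (unit3_nvec (mulVec_ne_zero_of_unit3 hF hn)), hF]

/-- Near the identity, the trace is second order on unimodular matrices. -/
theorem abs_trace_sub_three_le {A : Matrix (Fin 3) (Fin 3) ℝ} (hA : A.det = 1) {ε : ℝ}
    (hε1 : ε ≤ 1) (h : ∀ i j, |A i j - (1 : Matrix (Fin 3) (Fin 3) ℝ) i j| ≤ ε) :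
    |A.trace - 3| ≤ 12 * ε ^ 2 := by
  have hε0 : 0 ≤ ε := (abs_nonneg _).trans (h 0 0)
  obtain ⟨B, rfl⟩ : ∃ B, A = 1 + B := ⟨A - 1, by abel⟩
  simp only [Matrix.add_apply, add_sub_cancel_left] at h
  have h2 : ∀ i j k l, |B i j * B k l| ≤ ε ^ 2 := fun i j k l => by
    rw [abs_mul, sq]; exact mul_le_mul (h _ _) (h _ _) (abs_nonneg _) hε0
  have h3 : ∀ i j k l m o, |B i j * B k l * B m o| ≤ ε ^ 2 := fun i j k l m o => by
    rw [abs_mul]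
    calc _ ≤ ε ^ 2 * 1 := mul_le_mul (h2 _ _ _ _) ((h _ _).trans hε1) (abs_nonneg _) (sq_nonneg _)
      _ = _ := mul_one _
  simp [Matrix.det_fin_three] at hA
  simp only [Matrix.trace_fin_three, Matrix.add_apply, Matrix.one_apply_eq]
  have key : 1 + B 0 0 + (1 + B 1 1) + (1 + B 2 2) - 3 =
      -(B 0 0 * B 1 1) - B 0 0 * B 2 2 - B 1 1 * B 2 2 + B 0 1 * B 1 0 + B 0 2 * B 2 0
      + B 1 2 * B 2 1 - B 0 0 * B 1 1 * B 2 2 + B 0 0 * B 1 2 * B 2 1 + B 0 1 * B 1 0 * B 2 2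
      - B 0 1 * B 1 2 * B 2 0 - B 0 2 * B 1 0 * B 2 1 + B 0 2 * B 1 1 * B 2 0 := by
    linear_combination hA
  rw [key, abs_le]
  have a1 := abs_le.1 (h2 0 0 1 1)
  have a2 := abs_le.1 (h2 0 0 2 2)
  have a3 := abs_le.1 (h2 1 1 2 2)
  have a4 := abs_le.1 (h2 0 1 1 0)
  have a5 := abs_le.1 (h2 0 2 2 0)
  have a6 := abs_le.1 (h2 1 2 2 1)
  have b1 := abs_le.1 (h3 0 0 1 1 2 2)
  have b2 := abs_le.1 (h3 0 0 1 2 2 1)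
  have b3 := abs_le.1 (h3 0 1 1 0 2 2)
  have b4 := abs_le.1 (h3 0 1 1 2 2 0)
  have b5 := abs_le.1 (h3 0 2 1 0 2 1)
  have b6 := abs_le.1 (h3 0 2 1 1 2 0)
  constructor <;> linarith [a1.1, a1.2, a2.1, a2.2, a3.1, a3.2, a4.1, a4.2, a5.1, a5.2, a6.1, a6.2,
    b1.1, b1.2, b2.1, b2.2, b3.1, b3.2, b4.1, b4.2, b5.1, b5.2, b6.1, b6.2]

/-- The relative strain is trivial when the metric is the programmed one. -/
theorem relStrain_eq_one {s : ℝ} (hrf : 0 < rf) (hr0 : 0 < r0) (hs : 0 < s)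
    (hs2 : r0 ^ (-(1/3) : ℝ) * s ^ 2 = rf ^ (-(1/3) : ℝ)) (hn : unit3 n)
    (hC : Fᵀ * F = s ^ 2 • (1 + (rf / r0 - 1) • outer3 n n)) : relStrain rf r0 F n = 1 := by
  have hN := outer3_mul_self hn
  have hc : r0 ^ (-(1/3) : ℝ) ≠ 0 := (Real.rpow_pos_of_pos hr0 _).ne'
  have hd : ∑ j, (F *ᵥ n) j ^ 2 = s ^ 2 * (rf / r0) := by
    have h1 : ∑ j, (F *ᵥ n) j ^ 2 = (outer3 (F *ᵥ n) (F *ᵥ n)).trace := by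
      simp [Matrix.trace, outer3, sq]
    have h2 : (outer3 n n).trace = 1 := by
      simpa [unit3, Matrix.trace, outer3, sq] using hn
    rw [h1, outer3_mulVec, Matrix.trace_mul_comm, ← Matrix.mul_assoc, hC, Matrix.smul_mul, add_mul,
      Matrix.smul_mul, hN, one_mul, Matrix.trace_smul, Matrix.trace_add, Matrix.trace_smul, h2]
    simp
  have e : Fᵀ * (1 - ((1 - 1 / rf) / ∑ j, (F *ᵥ n) j ^ 2) • outer3 (F *ᵥ n) (F *ᵥ n)) * F =
      Fᵀ * F - ((1 - 1 / rf) / (s ^ 2 * (rf / r0))) • ((Fᵀ * F) * outer3 n n * (Fᵀ * F)) := by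
    rw [hd, outer3_mulVec]
    simp only [Matrix.mul_sub, Matrix.sub_mul, Matrix.mul_smul, Matrix.smul_mul, Matrix.mul_assoc,
      Matrix.mul_one]
  rw [relStrain, e, hC, ← hs2]
  simp only [add_mul, mul_add, sub_mul, one_mul, mul_one, Matrix.smul_mul, Matrix.mul_smul, hN,
    smul_add, smul_sub, smul_smul]
  match_scalars <;> field_simp
  ring

end

/-- The Jacobian of the lifting map, as a function of the gradient of the height. -/
def liftJac (s : ℝ) (g : Fin 2 → ℝ) : Matrix (Fin 3) (Fin 3) ℝ :=
  !![s, 0, 0; 0, s, 0; s * g 0, s * g 1, s⁻¹ ^ 2]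

/-- The in-plane shear that realizes the programmed metric. -/
def shearField (s l : ℝ) (i : Fin 2) (g : Fin 2 → ℝ) : ℝ :=
  (√(l - ∑ j, g j ^ 2) - s⁻¹ ^ 3) / (1 + ∑ j, g j ^ 2) * g i

/-- The director, as a function of the gradient of the height. -/
def director (l : ℝ) (g : Fin 2 → ℝ) : Fin 3 → ℝ := fun i : Fin 3 =>
  if h : (i : ℕ) < 2 then l ^ (-(1/2) : ℝ) * g ⟨i, h⟩
  else l ^ (-(1/2) : ℝ) * √(l - ∑ j, g j ^ 2)

section
variable {s l : ℝ} {g : Fin 2 → ℝ}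

theorem rpow_neg_half_sq (hl : 0 < l) : (l ^ (-(1/2) : ℝ)) ^ 2 * l = 1 := by
  rw [← Real.rpow_natCast, ← Real.rpow_mul hl.le]
  norm_num
  rw [Real.rpow_neg_one, inv_mul_cancel₀ hl.ne']

theorem director_zero : director l g 0 = l ^ (-(1/2) : ℝ) * g 0 := rfl

theorem director_one : director l g 1 = l ^ (-(1/2) : ℝ) * g 1 := rfl

theorem director_two : director l g 2 = l ^ (-(1/2) : ℝ) * √(l - ∑ j, g j ^ 2) := rfl

theorem liftJac_mul_shearJac (a b : ℝ) : liftJac s g * shearJac 0 a * shearJac 1 b =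
    !![s, 0, s * a; 0, s, s * b; s * g 0, s * g 1, s * g 0 * a + s * g 1 * b + s⁻¹ ^ 2] := by
  have h0 : shearJac 0 a = !![1, 0, a; 0, 1, 0; 0, 0, 1] := by
    ext i j; fin_cases i <;> fin_cases j <;> simp [shearJac]
  have h1 : shearJac 1 b = !![1, 0, 0; 0, 1, b; 0, 0, 1] := by
    ext i j; fin_cases i <;> fin_cases j <;> simp [shearJac]
  rw [h0, h1, liftJac]
  ext i j
  fin_cases i <;> fin_cases j <;> simp [Matrix.mul_apply, Fin.sum_univ_three]
  ring

theorem unit3_director (hl : 0 < l) (hg : ∑ j, g j ^ 2 ≤ l) : unit3 (director l g) := by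
  have h := Real.sq_sqrt (sub_nonneg.2 hg)
  have h2 := rpow_neg_half_sq hl
  simp only [unit3, Fin.sum_univ_three, director_zero, director_one, director_two,
    Fin.sum_univ_two] at h ⊢
  linear_combination (l ^ (-(1/2) : ℝ)) ^ 2 * h + h2

theorem gram_liftJac (hs : 0 < s) (hl : 0 < l) (hsl : s ^ 6 * (1 + l) = 1)
    (hg : ∑ j, g j ^ 2 ≤ l) :
    (liftJac s g * shearJac 0 (shearField s l 0 g) * shearJac 1 (shearField s l 1 g))ᵀ *
      (liftJac s g * shearJac 0 (shearField s l 0 g) * shearJac 1 (shearField s l 1 g)) =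
      s ^ 2 • (1 + l • outer3 (director l g) (director l g)) := by
  have hq := Real.sq_sqrt (sub_nonneg.2 hg)
  have hρ := rpow_neg_half_sq hl
  have hG : 0 ≤ ∑ j, g j ^ 2 := Finset.sum_nonneg fun _ _ => sq_nonneg _
  have d0 := director_zero (l := l) (g := g)
  have d1 := director_one (l := l) (g := g)
  have d2 := director_two (l := l) (g := g)
  rw [liftJac_mul_shearJac]
  simp only [shearField]
  generalize director l g = n at *
  rw [Fin.sum_univ_two] at *
  set q := √(l - (g 0 ^ 2 + g 1 ^ 2))
  set ρ := l ^ (-(1/2) : ℝ)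
  have hst : s * s⁻¹ = 1 := mul_inv_cancel₀ hs.ne'
  set t := s⁻¹
  have ha : (t ^ 3) ^ 2 = 1 + l := by
    calc (t ^ 3) ^ 2 = (t ^ 3) ^ 2 * (s ^ 6 * (1 + l)) := by rw [hsl, mul_one]
      _ = (s * t) ^ 6 * (1 + l) := by ring
      _ = _ := by rw [hst]; ring
  have h1G : 1 + (g 0 ^ 2 + g 1 ^ 2) ≠ 0 := by positivity
  set k := (q - t ^ 3) / (1 + (g 0 ^ 2 + g 1 ^ 2)) with hk
  have hk1 : k * (1 + (g 0 ^ 2 + g 1 ^ 2)) = q - t ^ 3 := by rw [hk]; field_simp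
  have hk2 : k * (q + t ^ 3) = -1 := by
    refine mul_left_cancel₀ h1G ?_
    linear_combination (q + t ^ 3) * hk1 + hq - ha
  have ht2 : t ^ 2 = s * t ^ 3 := by linear_combination -t ^ 2 * hst
  rw [ht2]
  generalize t ^ 3 = a at *
  clear_value k q ρ
  have e33 : k ^ 2 * (g 0 ^ 2 + g 1 ^ 2) + (k * (g 0 ^ 2 + g 1 ^ 2) + a) ^ 2 = 1 + q ^ 2 := by
    linear_combination k * (g 0 ^ 2 + g 1 ^ 2) * hk1 + (g 0 ^ 2 + g 1 ^ 2) * hk2 + ha - hq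
  ext i j
  fin_cases i <;> fin_cases j <;>
    simp [outer3, Matrix.mul_apply, Fin.sum_univ_three, Matrix.transpose_apply, d0, d1, d2]
  · linear_combination -s ^ 2 * g 0 ^ 2 * hρ
  · linear_combination -s ^ 2 * g 0 * g 1 * hρ
  · linear_combination s ^ 2 * g 0 * hk1 - s ^ 2 * g 0 * q * hρ
  · linear_combination -s ^ 2 * g 0 * g 1 * hρ
  · linear_combination -s ^ 2 * g 1 ^ 2 * hρ
  · linear_combination s ^ 2 * g 1 * hk1 - s ^ 2 * g 1 * q * hρ
  · linear_combination s ^ 2 * g 0 * hk1 - s ^ 2 * g 0 * q * hρ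
  · linear_combination s ^ 2 * g 1 * hk1 - s ^ 2 * g 1 * q * hρ
  · linear_combination s ^ 2 * e33 - s ^ 2 * q ^ 2 * hρ

end

section
variable {E : Type*} [NormedAddCommGroup E] [NormedSpace ℝ E]
  {A B : E → Matrix (Fin 3) (Fin 3) ℝ} {u w : E → Fin 3 → ℝ} {x : E}

theorem contDiffAt_matrix_mul (hA : ∀ i j, ContDiffAt ℝ 1 (fun p => A p i j) x)
    (hB : ∀ i j, ContDiffAt ℝ 1 (fun p => B p i j) x) (i j : Fin 3) :
    ContDiffAt ℝ 1 (fun p => (A p * B p) i j) x := by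
  simp only [Matrix.mul_apply]
  exact ContDiffAt.sum fun k _ => (hA i k).mul (hB k j)

theorem contDiffAt_matrix_mulVec (hA : ∀ i j, ContDiffAt ℝ 1 (fun p => A p i j) x)
    (hu : ∀ i, ContDiffAt ℝ 1 (fun p => u p i) x) (i : Fin 3) :
    ContDiffAt ℝ 1 (fun p => (A p *ᵥ u p) i) x := by
  simp only [Matrix.mulVec, dotProduct]
  exact ContDiffAt.sum fun k _ => (hA i k).mul (hu k)

theorem contDiffAt_relStrain (rf r0 : ℝ) (hA : ∀ i j, ContDiffAt ℝ 1 (fun p => A p i j) x)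
    (hu : ∀ i, ContDiffAt ℝ 1 (fun p => u p i) x) (hne : A x *ᵥ u x ≠ 0) (i j : Fin 3) :
    ContDiffAt ℝ 1 (fun p => relStrain rf r0 (A p) (u p) i j) x := by
  have hw := contDiffAt_matrix_mulVec hA hu
  have hS : ContDiffAt ℝ 1 (fun p => ∑ k, (A p *ᵥ u p) k ^ 2) x :=
    ContDiffAt.sum fun k _ => (hw k).pow 2
  have hq : ContDiffAt ℝ 1 (fun p => (1 - 1 / rf) / ∑ k, (A p *ᵥ u p) k ^ 2) x :=
    contDiffAt_const.div hS (sum_sq_pos hne).ne'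
  have h1 : ∀ i j, ContDiffAt ℝ 1 (fun p => (1 - ((1 - 1 / rf) / ∑ k, (A p *ᵥ u p) k ^ 2) •
      outer3 (A p *ᵥ u p) (A p *ᵥ u p)) i j) x := fun i j => by
    simp only [Matrix.sub_apply, Matrix.smul_apply, smul_eq_mul, outer3, Matrix.of_apply]
    exact contDiffAt_const.sub (hq.mul ((hw i).mul (hw j)))
  have h2 : ∀ i j, ContDiffAt ℝ 1 (fun p => (1 + (r0 - 1) • outer3 (u p) (u p)) i j) x :=
    fun i j => by
      simp only [Matrix.add_apply, Matrix.smul_apply, smul_eq_mul, outer3, Matrix.of_apply]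
      exact contDiffAt_const.add (contDiffAt_const.mul ((hu i).mul (hu j)))
  have hT : ∀ i j, ContDiffAt ℝ 1 (fun p => (A p)ᵀ i j) x := fun i j => hA j i
  have h3 := contDiffAt_matrix_mul (contDiffAt_matrix_mul (contDiffAt_matrix_mul hT h1) hA) h2 i j
  simp only [relStrain, Matrix.smul_apply, smul_eq_mul]
  exact contDiffAt_const.mul h3

end

theorem isCompact_sum_sq_le (c : ℝ) : IsCompact {g : Fin 2 → ℝ | ∑ j, g j ^ 2 ≤ c} := by
  refine Metric.isCompact_of_isClosed_isBounded
    (isClosed_le (by fun_prop) continuous_const) ?_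
  refine (Metric.isBounded_closedBall (x := 0) (r := 1 + |c|)).subset fun g hg => ?_
  rw [mem_closedBall_zero_iff, pi_norm_le_iff_of_nonneg (by positivity)]
  intro i
  have h1 : g i ^ 2 ≤ c :=
    (Finset.single_le_sum (f := fun j => g j ^ 2) (fun _ _ => sq_nonneg _)
      (Finset.mem_univ i)).trans hg
  rw [Real.norm_eq_abs]
  nlinarith [sq_abs (g i), le_abs_self c, abs_nonneg (g i), abs_nonneg c]

theorem contDiffAt_shearField {s l : ℝ} {g : Fin 2 → ℝ} (i : Fin 2) (hg : ∑ j, g j ^ 2 < l) :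
    ContDiffAt ℝ 1 (shearField s l i) g := by
  have hap : ∀ j : Fin 2, ContDiffAt ℝ 1 (fun g : Fin 2 → ℝ => g j) g :=
    fun j => (contDiff_apply ℝ ℝ j).contDiffAt
  have hS : ContDiffAt ℝ 1 (fun g : Fin 2 → ℝ => ∑ j, g j ^ 2) g :=
    ContDiffAt.sum fun k _ => (hap k).pow 2
  have hn : 0 ≤ ∑ j, g j ^ 2 := Finset.sum_nonneg fun _ _ => sq_nonneg _
  exact ((((contDiffAt_const.sub hS).sqrt (sub_pos.2 hg).ne').sub contDiffAt_const).div
    (contDiffAt_const.add hS) (by positivity)).mul (hap i)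

theorem continuous_shearField (s l : ℝ) (i : Fin 2) : Continuous (shearField s l i) := by
  unfold shearField
  refine Continuous.mul (Continuous.div (by fun_prop) (by fun_prop) fun g => ?_) (by fun_prop)
  have hn : 0 ≤ ∑ j, g j ^ 2 := Finset.sum_nonneg fun _ _ => sq_nonneg _
  positivity

/-- Quadratic smallness of the entropic energy near the zero-energy deformations. -/
theorem exists_abs_We_le {rf r0 s c : ℝ} (μ : ℝ) (hrf : 0 < rf) (hr0 : 0 < r0) (hs : 0 < s)
    (hr : 1 < rf / r0) (hc : c < rf / r0 - 1) (hsr : s ^ 6 * (rf / r0) = 1)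
    (hs2 : r0 ^ (-(1/3) : ℝ) * s ^ 2 = rf ^ (-(1/3) : ℝ)) :
    ∃ δ > 0, ∃ L > 0, ∀ g : Fin 2 → ℝ, ∑ j, g j ^ 2 ≤ c →
      ∀ (T P₀ P₁ : Matrix (Fin 3) (Fin 3) ℝ) (n : Fin 3 → ℝ) (ε : ℝ), 0 ≤ ε → ε < δ →
      (∀ i j, |T i j - liftJac s g i j| ≤ ε) →
      (∀ i j, |P₀ i j - shearJac 0 (shearField s (rf / r0 - 1) 0 g) i j| ≤ ε) →
      (∀ i j, |P₁ i j - shearJac 1 (shearField s (rf / r0 - 1) 1 g) i j| ≤ ε) →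
      (∀ i, |n i - director (rf / r0 - 1) g i| ≤ ε) → unit3 n → (T * P₀ * P₁).det = 1 →
      |We μ rf r0 (T * P₀ * P₁) (nvec ((T * P₀ * P₁).mulVec n)) n| ≤ L * ε ^ 2 := by
  have hl : 0 < rf / r0 - 1 := by linarith
  set l := rf / r0 - 1 with hldef
  let X := (Fin 3 → Fin 3 → ℝ) × (Fin 3 → Fin 3 → ℝ) × (Fin 3 → Fin 3 → ℝ) × (Fin 3 → ℝ)
  let D : X → Matrix (Fin 3) (Fin 3) ℝ := fun p =>
    Matrix.of p.1 * Matrix.of p.2.1 * Matrix.of p.2.2.1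
  let ψ : X → Fin 3 → Fin 3 → ℝ := fun p => relStrain rf r0 (D p) p.2.2.2
  let Φ : (Fin 2 → ℝ) → X := fun g => (liftJac s g, shearJac 0 (shearField s l 0 g),
    shearJac 1 (shearField s l 1 g), director l g)
  have hΦ : Continuous Φ := by
    have hG : Continuous fun g : Fin 2 → ℝ => ∑ j, g j ^ 2 := by fun_prop
    refine Continuous.prodMk ?_ (Continuous.prodMk ?_ (Continuous.prodMk ?_ ?_))
    · refine continuous_pi fun i => continuous_pi fun j => ?_
      fin_cases i <;> fin_cases j <;> simp [liftJac] <;> fun_prop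
    · refine continuous_pi fun i => continuous_pi fun j => ?_
      have := continuous_shearField s l 0
      simp only [shearJac, Matrix.add_apply, Matrix.single_apply]
      split_ifs <;> fun_prop
    · refine continuous_pi fun i => continuous_pi fun j => ?_
      have := continuous_shearField s l 1
      simp only [shearJac, Matrix.add_apply, Matrix.single_apply]
      split_ifs <;> fun_prop
    · refine continuous_pi fun i => ?_
      simp only [director]
      split_ifs <;> fun_prop
  have hdetΦ : ∀ g, (D (Φ g)).det = 1 := fun g => by
    change (liftJac s g * shearJac 0 _ * shearJac 1 _).det = 1
    rw [liftJac_mul_shearJac]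
    simp [Matrix.det_fin_three]
    field_simp
    ring
  obtain ⟨δ, hδ, L, hL, hlip⟩ := lipschitz_near_compact
    (f := ψ) ((isCompact_sum_sq_le c).image hΦ) (by
      rintro _ ⟨g, hg, rfl⟩
      have hP : ∀ p q : Fin 3, ContDiff ℝ 1 (fun f : Fin 3 → Fin 3 → ℝ => f p q) :=
        fun p q => (contDiff_apply_apply ℝ ℝ p q)
      refine contDiffAt_pi.2 fun i => contDiffAt_pi.2 fun j => contDiffAt_relStrain rf r0
        (contDiffAt_matrix_mul (contDiffAt_matrix_mul
          (fun i j => ((hP i j).comp contDiff_fst).contDiffAt)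
          (fun i j => ((hP i j).comp (contDiff_fst.comp contDiff_snd)).contDiffAt))
          (fun i j => ((hP i j).comp (contDiff_fst.comp
            (contDiff_snd.comp contDiff_snd))).contDiffAt))
        (fun i => ((contDiff_apply ℝ ℝ i).comp (contDiff_snd.comp
            (contDiff_snd.comp contDiff_snd))).contDiffAt) ?_ i j
      exact mulVec_ne_zero_of_unit3 (hdetΦ g) (unit3_director hl (le_trans hg hc.le)))
  refine ⟨min δ (1 / L), lt_min hδ (by positivity), 6 * |μ| * L ^ 2 + 1, by positivity, ?_⟩
  intro g hg T P₀ P₁ n ε hε hεδ hT hP₀ hP₁ hn hn1 hdet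
  let p : X := (T, P₀, P₁, n)
  have hp : dist p (Φ g) ≤ ε := by
    refine max_le ?_ (max_le ?_ (max_le ?_ ?_))
    · exact (dist_pi_le_iff hε).2 fun i => (dist_pi_le_iff hε).2 fun j => hT i j
    · exact (dist_pi_le_iff hε).2 fun i => (dist_pi_le_iff hε).2 fun j => hP₀ i j
    · exact (dist_pi_le_iff hε).2 fun i => (dist_pi_le_iff hε).2 fun j => hP₁ i j
    · exact (dist_pi_le_iff hε).2 fun i => hn i
  have hψ := hlip _ ⟨g, hg, rfl⟩ p (hp.trans_lt (hεδ.trans_le (min_le_left _ _)))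
  have hψ1 : ψ (Φ g) = (1 : Matrix (Fin 3) (Fin 3) ℝ) := by
    refine relStrain_eq_one hrf hr0 hs hs2 (unit3_director hl (le_trans hg hc.le)) ?_
    have := gram_liftJac hs hl (by rw [hldef, add_sub_cancel]; exact hsr) (le_trans hg hc.le)
    exact this
  have hLε : L * ε ≤ 1 := by
    have := (hεδ.trans_le (min_le_right _ _)).le
    rw [le_div_iff₀ hL] at this
    linarith
  have hLε0 : 0 ≤ L * ε := by positivity
  have hent : ∀ i j, |relStrain rf r0 (T * P₀ * P₁) n i j -
      (1 : Matrix (Fin 3) (Fin 3) ℝ) i j| ≤ L * ε := fun i j => by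
    have h1 : dist (ψ p) (ψ (Φ g)) ≤ L * ε := hψ.trans (by gcongr)
    have h2 := (dist_pi_le_iff hLε0).1 ((dist_pi_le_iff hLε0).1 h1 i) j
    rw [hψ1] at h2
    exact h2
  have htr := abs_trace_sub_three_le (det_relStrain hrf hr0 hdet hn1) hLε hent
  rw [We, relStrain_eq hrf hdet hn1, abs_mul, abs_div, abs_two]
  calc |μ| / 2 * |(relStrain rf r0 (T * P₀ * P₁) n).trace - 3| ≤ |μ| / 2 * (12 * (L * ε) ^ 2) := by
        gcongr
    _ = 6 * |μ| * L ^ 2 * ε ^ 2 := by ring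
    _ ≤ _ := by nlinarith [sq_nonneg ε]

theorem abs_shearJac_sub_le (i : Fin 2) (a b : ℝ) (k j : Fin 3) :
    |shearJac i a k j - shearJac i b k j| ≤ |a - b| := by
  simp only [shearJac, Matrix.add_apply, Matrix.single_apply, add_sub_add_left_eq_sub]
  split_ifs <;> simp

theorem abs_liftJac_sub_le {s e : ℝ} (hs : 0 ≤ s) (he : 0 ≤ e) {g g' : Fin 2 → ℝ}
    (h : ∀ i, |g i - g' i| ≤ e) (k j : Fin 3) : |liftJac s g k j - liftJac s g' k j| ≤ s * e := by
  have h0 : 0 ≤ s * e := mul_nonneg hs he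
  have h1 : ∀ i, |s * g i - s * g' i| ≤ s * e := fun i => by
    rw [← mul_sub, abs_mul, abs_of_nonneg hs]
    exact mul_le_mul_of_nonneg_left (h i) hs
  fin_cases k <;> fin_cases j <;> simp [liftJac, h0, h1]

/-- The volume preserving lifting map over the graph of a height function. -/
def liftMap (s : ℝ) (φ : (Fin 2 → ℝ) → ℝ) (x : Fin 3 → ℝ) : Fin 3 → ℝ :=
  s • x + ((s⁻¹ ^ 2 - s) * x 2 + φ (s • proj2 x)) • (Pi.single 2 1 : Fin 3 → ℝ)

/-- The lifted surface of a height function. -/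
def liftSurf (s : ℝ) (φ : (Fin 2 → ℝ) → ℝ) (xt : Fin 2 → ℝ) : Fin 3 → ℝ := fun i : Fin 3 =>
  if h : (i : ℕ) < 2 then s * xt ⟨i, h⟩ else φ (s • xt)

section
variable {φ ψ : (Fin 2 → ℝ) → ℝ} {s : ℝ}

theorem liftMap_emb (s : ℝ) (φ : (Fin 2 → ℝ) → ℝ) (xt : Fin 2 → ℝ) :
    liftMap s φ (emb xt 0) = liftSurf s φ xt := by
  have h : proj2 (emb xt 0) = xt := by ext j; fin_cases j <;> rfl
  ext i
  fin_cases i <;> simp [liftMap, liftSurf, h] <;> simp [emb]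

theorem contDiff_liftMap {n : WithTop ℕ∞} (hφ : ContDiff ℝ n φ) :
    ContDiff ℝ n (liftMap s φ) := by
  have hpr : ContDiff ℝ n (fun x : Fin 3 → ℝ => s • proj2 x) := proj2L.contDiff.const_smul s
  have h2 : ContDiff ℝ n (fun x : Fin 3 → ℝ => x 2) := contDiff_apply ℝ ℝ 2
  exact (contDiff_id.const_smul s).add
    (((contDiff_const.mul h2).add (hφ.comp hpr)).smul contDiff_const)

theorem jac3_liftMap (hφ : Differentiable ℝ φ) (x : Fin 3 → ℝ) :
    jac3 (liftMap s φ) x = liftJac s (grad2 φ (s • proj2 x)) := by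
  have hpr : HasFDerivAt (fun x : Fin 3 → ℝ => s • proj2 x) (s • proj2L) x :=
    proj2L.hasFDerivAt.const_smul s
  have hR : HasFDerivAt (fun x : Fin 3 → ℝ => x 2)
    (ContinuousLinearMap.proj (R := ℝ) (φ := fun _ : Fin 3 => ℝ) 2) x := hasFDerivAt_apply 2 x
  have hφx : HasFDerivAt (fun x : Fin 3 → ℝ => φ (s • proj2 x)) _ x :=
    (hφ (s • proj2 x)).hasFDerivAt.comp x hpr
  have h : HasFDerivAt (liftMap s φ) _ x := ((hasFDerivAt_id x).const_smul s).add
    (((hR.const_mul (s⁻¹ ^ 2 - s)).add hφx).smul_const _)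
  have h2 : proj2 (Pi.single 2 1) = 0 := by ext j; fin_cases j <;> simp [proj2]
  have h0 : proj2 (Pi.single 0 1) = Pi.single 0 1 := by ext j; fin_cases j <;> simp [proj2]
  have h1 : proj2 (Pi.single 1 1) = Pi.single 1 1 := by ext j; fin_cases j <;> simp [proj2]
  ext k j
  simp only [jac3, Matrix.of_apply, h.fderiv]
  fin_cases k <;> fin_cases j <;> simp [liftJac, grad2, proj2L_apply, h0, h1, h2]

theorem contDiff_liftSurf {n : WithTop ℕ∞} (hφ : ContDiff ℝ n φ) :
    ContDiff ℝ n (liftSurf s φ) := by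
  refine contDiff_pi.2 fun i => ?_
  unfold liftSurf
  split_ifs
  · exact contDiff_const.mul (contDiff_apply ℝ ℝ _)
  · exact hφ.comp (contDiff_id.const_smul s)

theorem jac32_liftSurf_sub (hφ : ContDiff ℝ 1 φ) (hψ : ContDiff ℝ 1 ψ) (x : Fin 2 → ℝ)
    (i : Fin 3) (j : Fin 2) : (jac32 (liftSurf s φ) x - jac32 (liftSurf s ψ) x) i j =
      if i = 2 then s * (grad2 φ (s • x) j - grad2 ψ (s • x) j) else 0 := by
  have key : ∀ {χ : (Fin 2 → ℝ) → ℝ}, ContDiff ℝ 1 χ → jac32 (liftSurf s χ) x i j =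
      fderiv ℝ (fun z => liftSurf s χ z i) x (Pi.single j 1) := fun hχ => by
    have := ((contDiff_liftSurf (s := s) hχ).differentiable one_ne_zero x).hasFDerivAt
    rw [(hasFDerivAt_pi'.1 this i).fderiv]
    rfl
  rw [Matrix.sub_apply, key hφ, key hψ]
  by_cases hi : i = 2
  · subst hi
    simp only [liftSurf, if_true]
    simp only [show ¬ ((2 : Fin 3) : ℕ) < 2 by decide, dite_false]
    rw [fderiv_comp_dilation (hφ.differentiable one_ne_zero _),
      fderiv_comp_dilation (hψ.differentiable one_ne_zero _)]
    simp [grad2, mul_sub]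
  · have : (i : ℕ) < 2 := by fin_cases i <;> simp_all
    simp [liftSurf, this, hi]

theorem liftSurf_sub_apply (x : Fin 2 → ℝ) (i : Fin 3) : liftSurf s φ x i - liftSurf s ψ x i =
      if i = 2 then φ (s • x) - ψ (s • x) else 0 := by
  fin_cases i <;> simp [liftSurf]

theorem sqrt_add_sqrt_liftSurf_le (hφ : ContDiff ℝ 1 φ) (hψ : ContDiff ℝ 1 ψ) (hs : 0 ≤ s)
    (hs1 : s ≤ 1) {e : ℝ} (h0 : ∀ x, |φ x - ψ x| ≤ e) (h1 : ∀ x i, |grad2 φ x i - grad2 ψ x i| ≤ e)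
    (x : Fin 2 → ℝ) : √(∑ i, (liftSurf s φ x i - liftSurf s ψ x i) ^ 2) +
      √(frob2 (jac32 (liftSurf s φ) x - jac32 (liftSurf s ψ) x)) ≤ 3 * e := by
  have he : 0 ≤ e := (abs_nonneg _).trans (h0 0)
  have hsq : ∀ j, (s * (grad2 φ (s • x) j - grad2 ψ (s • x) j)) ^ 2 ≤ e ^ 2 := fun j => by
    refine sq_le_sq' ?_ ?_ <;> have := abs_le.1 (h1 (s • x) j) <;> nlinarith [this.1, this.2]
  have a1 : √(∑ i, (liftSurf s φ x i - liftSurf s ψ x i) ^ 2) ≤ e := by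
    refine Real.sqrt_le_iff.2 ⟨he, ?_⟩
    simp only [liftSurf_sub_apply, Fin.sum_univ_three]
    simpa using sq_le_sq.2 ((h0 (s • x)).trans (le_abs_self e))
  have a2 : √(frob2 (jac32 (liftSurf s φ) x - jac32 (liftSurf s ψ) x)) ≤ 2 * e := by
    refine Real.sqrt_le_iff.2 ⟨by positivity, ?_⟩
    simp only [frob2, jac32_liftSurf_sub hφ hψ, Fin.sum_univ_three, Fin.sum_univ_two]
    have b0 := hsq 0
    have b1 := hsq 1
    simp
    nlinarith
  linarith

end

/-- A smooth function that approximates a Lipschitz function at scale `h`. -/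
structure IsRegularization (V : (Fin 2 → ℝ) → ℝ) (M h : ℝ) (v : (Fin 2 → ℝ) → ℝ) : Prop where
  contDiff : ContDiff ℝ 3 v
  abs_le : ∀ z, |v z| ≤ M
  abs_sub_le : ∀ z, |v z - V z| ≤ M * h
  norm_fderiv_le : ∀ z, ‖fderiv ℝ v z‖ ≤ M
  norm_fderiv_fderiv_le : ∀ i z, ‖fderiv ℝ (fun z => fderiv ℝ v z (Pi.single i 1)) z‖ ≤ M / h

theorem IsRegularization.mono {V v : (Fin 2 → ℝ) → ℝ} {M M' h : ℝ} (hv : IsRegularization V M h v)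
    (hh : 0 < h) (hM : M ≤ M') : IsRegularization V M' h v where
  contDiff := hv.contDiff
  abs_le z := (hv.abs_le z).trans hM
  abs_sub_le z := (hv.abs_sub_le z).trans (by gcongr)
  norm_fderiv_le z := (hv.norm_fderiv_le z).trans hM
  norm_fderiv_fderiv_le i z := (hv.norm_fderiv_fderiv_le i z).trans (by gcongr)

theorem exists_isRegularization {V : (Fin 2 → ℝ) → ℝ} {K : NNReal} {B : ℝ}
    (hV : LipschitzWith K V) (hB : ∀ z, |V z| ≤ B) :
    ∃ M, 0 < M ∧ ∀ h, 0 < h → h ≤ 1 → ∃ v, IsRegularization V M h v := by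
  obtain ⟨M, hM, H⟩ := exists_mollification_lipschitz hV
  have hB0 : 0 ≤ B := (abs_nonneg _).trans (hB 0)
  refine ⟨B + M, by positivity, fun h hh hh1 => ?_⟩
  obtain ⟨v, h3, h0, h1, h2⟩ := H h hh
  have hMB : M ≤ B + M := by linarith
  refine ⟨v, h3, fun z => ?_, fun z => (h0 z).trans (by gcongr), fun z => (h1 z).trans hMB,
    fun i z => (h2 i z).trans (by gcongr)⟩
  have a1 : |v z| ≤ |V z| + |v z - V z| := by
    have := abs_add_le (V z) (v z - V z)
    rwa [add_sub_cancel] at this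
  have a2 : M * h ≤ M := mul_le_of_le_one_right hM.le hh1
  linarith [hB z, h0 z]

theorem exists_lipschitz_shearField_comp {G : (Fin 2 → ℝ) → Fin 2 → ℝ} {K : NNReal} {c l : ℝ}
    (hG : LipschitzWith K G) (hc : c < l) (hGc : ∀ x, ∑ j, G x j ^ 2 ≤ c) (s : ℝ) (i : Fin 2) :
    ∃ K' : NNReal, ∃ B, LipschitzWith K' (fun x => shearField s l i (G x)) ∧
      ∀ x, |shearField s l i (G x)| ≤ B := by
  obtain ⟨K', hK'⟩ := exists_lipschitzOnWith_of_isCompact (isCompact_sum_sq_le c)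
    (f := shearField s l i) (fun g hg => contDiffAt_shearField i (lt_of_le_of_lt hg hc))
  obtain ⟨B, hB⟩ := (isCompact_sum_sq_le c).exists_bound_of_continuousOn
    (continuous_shearField s l i).continuousOn
  refine ⟨K' * K, B, ?_, fun x => hB _ (hGc x)⟩
  rw [← lipschitzOnWith_univ]
  exact hK'.comp hG.lipschitzOnWith fun x _ => hGc x

section
variable {s M h : ℝ} {ψ φ V₀ V₁ v₀ v₁ : (Fin 2 → ℝ) → ℝ} {x : Fin 3 → ℝ}

theorem abs_shear_two_le (i : Fin 2) (v : (Fin 2 → ℝ) → ℝ) (x : Fin 3 → ℝ) :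
    |shear i v x 2| ≤ 2 * |x 2| := by
  rw [shear_two]; exact abs_quadRoot_le _ _

/-- The incompressible extension of a lifted surface, sheared to carry the director. -/
def sheetMap (s : ℝ) (ψ v₀ v₁ : (Fin 2 → ℝ) → ℝ) (x : Fin 3 → ℝ) : Fin 3 → ℝ :=
  liftMap s ψ (shear 0 v₀ (shear 1 v₁ x))

theorem sheetMap_emb (s : ℝ) (ψ v₀ v₁ : (Fin 2 → ℝ) → ℝ) (xt : Fin 2 → ℝ) :
    sheetMap s ψ v₀ v₁ (emb xt 0) = liftSurf s ψ xt := by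
  have h : emb xt 0 2 = 0 := rfl
  rw [sheetMap, shear_plane 1 v₁ h, shear_plane 0 v₀ h, liftMap_emb]

theorem shear_arg_le (i : Fin 2) (v : (Fin 2 → ℝ) → ℝ) (hM : 0 ≤ M) (hx : M * |x 2| ≤ 1 / 16) :
    M * |shear i v x 2| ≤ 1 / 8 := by
  have := mul_le_mul_of_nonneg_left (abs_shear_two_le i v x) hM
  linarith

theorem contDiffAt_sheetMap (hψ : ContDiff ℝ 3 ψ) (hM : 0 ≤ M) (h₀ : IsRegularization V₀ M h v₀)
    (h₁ : IsRegularization V₁ M h v₁) (hx : M * |x 2| ≤ 1 / 16) :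
    ContDiffAt ℝ 1 (sheetMap s ψ v₀ v₁) x := by
  have a1 := contDiffAt_shear (i := 1) h₁.contDiff h₁.norm_fderiv_le (hx.trans (by norm_num))
  have a0 := contDiffAt_shear (i := 0) h₀.contDiff h₀.norm_fderiv_le (shear_arg_le 1 v₁ hM hx)
  exact ((contDiff_liftMap (hψ.of_le (by norm_num))).contDiffAt.comp _ a0).comp x a1

theorem jac3_sheetMap (hψ : ContDiff ℝ 3 ψ) (hM : 0 ≤ M) (h₀ : IsRegularization V₀ M h v₀)
    (h₁ : IsRegularization V₁ M h v₁) (hx : M * |x 2| ≤ 1 / 16) :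
    jac3 (sheetMap s ψ v₀ v₁) x =
      liftJac s (grad2 ψ (s • proj2 (shear 0 v₀ (shear 1 v₁ x)))) *
        jac3 (shear 0 v₀) (shear 1 v₁ x) * jac3 (shear 1 v₁) x := by
  have a1 := (contDiffAt_shear (i := 1) h₁.contDiff h₁.norm_fderiv_le
    (hx.trans (by norm_num))).differentiableAt one_ne_zero
  have a0 := (contDiffAt_shear (i := 0) h₀.contDiff h₀.norm_fderiv_le
    (shear_arg_le 1 v₁ hM hx)).differentiableAt one_ne_zero
  have aL : Differentiable ℝ (liftMap s ψ) :=
    (contDiff_liftMap hψ).differentiable (by norm_num)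
  have e1 : jac3 (sheetMap s ψ v₀ v₁) x = jac3 (fun z => liftMap s ψ (shear 0 v₀ z))
      (shear 1 v₁ x) * jac3 (shear 1 v₁) x :=
    jac3_comp (f := fun z => liftMap s ψ (shear 0 v₀ z)) ((aL _).comp _ a0) a1
  rw [e1, jac3_comp (aL _) a0, jac3_liftMap (hψ.differentiable (by norm_num))]

theorem det_liftJac (hs : s ≠ 0) (g : Fin 2 → ℝ) : (liftJac s g).det = 1 := by
  simp [liftJac, Matrix.det_fin_three]
  field_simp

theorem det_jac3_sheetMap (hs : s ≠ 0) (hψ : ContDiff ℝ 3 ψ) (hM : 0 ≤ M)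
    (h₀ : IsRegularization V₀ M h v₀) (h₁ : IsRegularization V₁ M h v₁)
    (hx : M * |x 2| ≤ 1 / 16) : (jac3 (sheetMap s ψ v₀ v₁) x).det = 1 := by
  rw [jac3_sheetMap hψ hM h₀ h₁ hx, Matrix.det_mul, Matrix.det_mul, det_liftJac hs,
    det_jac3_shear h₁.contDiff h₁.norm_fderiv_le (hx.trans (by norm_num)),
    det_jac3_shear h₀.contDiff h₀.norm_fderiv_le (shear_arg_le 1 v₁ hM hx)]
  norm_num

theorem abs_jac3_shear_sub_field_le (hM : 0 < M) (hh : 0 < h) {i : Fin 2}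
    (h₀ : IsRegularization V₀ M h v₀) (hV : ∀ a b, |V₀ a - V₀ b| ≤ M * dist a b)
    (hMh : M * h ≤ 1 / 8) (hx : |x 2| ≤ h) {z : Fin 3 → ℝ} (hz : dist x z ≤ (2 * M + 3) * h)
    (k j : Fin 3) :
    |jac3 (shear i v₀) x k j - shearJac i (V₀ (proj2 z)) k j| ≤ (10 * M ^ 2 + 14 * M) * h := by
  have a1 := abs_jac3_shear_sub_le h₀.contDiff hM h₀.abs_le h₀.norm_fderiv_le hh
    (h₀.norm_fderiv_fderiv_le i) hMh hx k j
  have a2 := abs_shearJac_sub_le i (v₀ (proj2 x)) (V₀ (proj2 z)) k j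
  have a3 := abs_sub_le (v₀ (proj2 x)) (V₀ (proj2 x)) (V₀ (proj2 z))
  have a4 : M * dist (proj2 x) (proj2 z) ≤ M * ((2 * M + 3) * h) := by
    gcongr; exact (dist_proj2_le x z).trans hz
  have a5 := abs_sub_le (jac3 (shear i v₀) x k j) (shearJac i (v₀ (proj2 x)) k j)
    (shearJac i (V₀ (proj2 z)) k j)
  nlinarith [h₀.abs_sub_le (proj2 x), hV (proj2 x) (proj2 z)]

/-- The lifting factor of the sheet Jacobian is close to its value on the midsurface. -/
theorem abs_liftJac_sheet_sub_le (hM : 0 < M) (hh : 0 < h) (hs : 0 ≤ s) (hs1 : s ≤ 1)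
    (hφψ : ∀ z i, |grad2 ψ z i - grad2 φ z i| ≤ M * h)
    (hφ : ∀ a b i, |grad2 φ a i - grad2 φ b i| ≤ M * dist a b)
    {z : Fin 3 → ℝ} (hz : dist z x ≤ 2 * ((2 * M + 3) * h)) (k j : Fin 3) :
    |liftJac s (grad2 ψ (s • proj2 z)) k j - liftJac s (grad2 φ (s • proj2 x)) k j| ≤
      (10 * M ^ 2 + 14 * M) * h := by
  have hd : dist (s • proj2 z) (s • proj2 x) ≤ 2 * ((2 * M + 3) * h) := by
    rw [dist_smul₀, Real.norm_of_nonneg hs]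
    have := (dist_proj2_le z x).trans hz
    exact (mul_le_of_le_one_left dist_nonneg hs1).trans this
  refine (abs_liftJac_sub_le hs (e := M * h + M * (2 * ((2 * M + 3) * h))) (by positivity)
    (fun i => ?_) k j).trans ?_
  · refine (abs_sub_le _ (grad2 φ (s • proj2 z) i) _).trans (add_le_add (hφψ _ _) ?_)
    exact (hφ _ _ i).trans (by gcongr)
  · refine (mul_le_of_le_one_left (by positivity) hs1).trans ?_
    nlinarith [mul_pos hM hh, mul_pos (mul_pos hM hM) hh]

end

theorem volume_slab_le {ω : Set (Fin 2 → ℝ)} {R h : ℝ} (hR : 0 < R)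
    (hω : ∀ x ∈ ω, ‖x‖ ≤ R) (hh : 0 < h) :
    volume (slab ω h) ≤ ENNReal.ofReal (4 * R ^ 2 * h) := by
  have hsub : slab ω h ⊆ Set.Icc ![-R, -R, -(h / 2)] ![R, R, h / 2] := by
    intro x hx
    have hb : ∀ j, |x (Fin.castSucc j)| ≤ R := fun j =>
      (norm_le_pi_norm (proj2 x) j).trans (hω _ hx.1)
    have h0 := abs_le.1 (hb 0)
    have h1 := abs_le.1 (hb 1)
    have h2 := hx.2
    constructor <;> intro i <;> fin_cases i
    exacts [h0.1, h1.1, h2.1.le, h0.2, h1.2, h2.2.le]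
  refine (measure_mono hsub).trans ?_
  rw [Real.volume_Icc_pi, ← ENNReal.ofReal_prod_of_nonneg]
  · refine ENNReal.ofReal_le_ofReal (le_of_eq ?_)
    rw [Fin.prod_univ_three]
    change (R - -R) * (R - -R) * (h / 2 - -(h / 2)) = _
    ring
  · intro i _
    fin_cases i <;> simp <;> linarith

theorem isOpen_slab {ω : Set (Fin 2 → ℝ)} (hω : IsOpen ω) (h : ℝ) : IsOpen (slab ω h) :=
  (hω.preimage proj2L.continuous).inter (isOpen_Ioo.preimage (continuous_apply 2))

theorem closure_slab_subset (ω : Set (Fin 2 → ℝ)) (h : ℝ) :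
    closure (slab ω h) ⊆ {x | |x 2| ≤ h / 2} :=
  closure_minimal (fun _ hx => abs_le.2 ⟨hx.2.1.le, hx.2.2.le⟩)
    (isClosed_le (by fun_prop) continuous_const)

/-- lifted surfaces are pure bending: for `r = r_f/r₀ > 1`, `λ = r-1`,
a height function `φ ∈ C^{1,1}` with `sup|∇φ|² < λ` supported in `r^{-1/6}·ω_m`, the
lifted surface `y` and director `n₀` admit, for all small `h`, a `C³` approximation
`y^h` (within `Ch` in `W^{1,∞}`) and an incompressible `C¹` extension `Y^h` with
entropic energy at most `C h³` for every admissible programmed director `N₀^h`. -/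
theorem statement17
    (ω : Set (Fin 2 → ℝ)) (hω : IsOpen ω) (hbd : Bornology.IsBounded ω) (hconn : IsConnected ω)
    (r0 rf μ τ m : ℝ) (hr0 : 1 ≤ r0) (hrf : 1 ≤ rf) (hr : 1 < rf / r0)
    (hμ : 0 < μ) (hτ : 0 < τ) (hm : 0 < m)
    (φ : (Fin 2 → ℝ) → ℝ) (hφ : ContDiff ℝ 1 φ)
    (K : NNReal) (hlip : LipschitzWith K (grad2 φ))
    (c : ℝ) (hclt : c < rf / r0 - 1) (hgrad : ∀ x, ∑ j, (grad2 φ x j) ^ 2 ≤ c)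
    (hsupp : Function.support φ ⊆
      (fun z : Fin 2 → ℝ => (rf / r0) ^ (-(1/6) : ℝ) • z) ''
        {xt ∈ ω | m < Metric.infDist xt (frontier ω)})
    (y : (Fin 2 → ℝ) → Fin 3 → ℝ)
    (hy : y = fun xt => fun i : Fin 3 =>
      if h : (i : ℕ) < 2 then (rf / r0) ^ (-(1/6) : ℝ) * xt ⟨i, h⟩
      else φ ((rf / r0) ^ (-(1/6) : ℝ) • xt))
    (n0 : (Fin 2 → ℝ) → Fin 3 → ℝ)
    (hn0 : n0 = fun xt => fun i : Fin 3 =>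
      if h : (i : ℕ) < 2 then
        (rf / r0 - 1) ^ (-(1/2) : ℝ) * grad2 φ ((rf / r0) ^ (-(1/6) : ℝ) • xt) ⟨i, h⟩
      else
        (rf / r0 - 1) ^ (-(1/2) : ℝ) *
          Real.sqrt ((rf / r0 - 1) - ∑ j, (grad2 φ ((rf / r0) ^ (-(1/6) : ℝ) • xt) j) ^ 2)) :
    ∃ C : ℝ, 0 < C ∧ ∃ h₀ : ℝ, 0 < h₀ ∧ ∀ h : ℝ, 0 < h → h < h₀ →
      ∃ yh : (Fin 2 → ℝ) → Fin 3 → ℝ, ∃ Y : (Fin 3 → ℝ) → Fin 3 → ℝ,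
        (∃ U, IsOpen U ∧ closure ω ⊆ U ∧ ContDiffOn ℝ 3 yh U) ∧
        (∃ U, IsOpen U ∧ closure (slab ω h) ⊆ U ∧ ContDiffOn ℝ 1 Y U) ∧
        (∀ xt ∈ ω, Y (emb xt 0) = yh xt) ∧
        (∀ xt ∈ ω,
          Real.sqrt (∑ i, (yh xt i - y xt i) ^ 2) +
            Real.sqrt (frob2 (jac32 yh xt - jac32 y xt)) ≤ C * h) ∧
        (∀ x ∈ slab ω h, (jac3 Y x).det = 1) ∧
        (∀ N0 : (Fin 3 → ℝ) → Fin 3 → ℝ, Measurable N0 →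
          (∀ᵐ x ∂(volume.restrict (slab ω h)),
            unit3 (N0 x) ∧ ∑ i, (N0 x i - n0 (proj2 x) i) ^ 2 ≤ (τ * h) ^ 2) →
          (∫ x in slab ω h,
            We μ rf r0 (jac3 Y x) (nvec ((jac3 Y x).mulVec (N0 x))) (N0 x)) ≤ C * h ^ 3) := by
  set s := (rf / r0) ^ (-(1/6) : ℝ) with hs_def
  have hrf0 : 0 < rf := by linarith
  have hr00 : 0 < r0 := by linarith
  have hr_pos : 0 < rf / r0 := by linarith
  have hs : 0 < s := Real.rpow_pos_of_pos hr_pos _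
  have hs1 : s ≤ 1 := Real.rpow_le_one_of_one_le_of_nonpos hr.le (by norm_num)
  have hsr : s ^ 6 * (rf / r0) = 1 := by
    rw [hs_def, ← Real.rpow_natCast, ← Real.rpow_mul hr_pos.le]
    norm_num
    rw [Real.rpow_neg_one, inv_mul_cancel₀ hr_pos.ne']
  have hs2 : r0 ^ (-(1/3) : ℝ) * s ^ 2 = rf ^ (-(1/3) : ℝ) := by
    rw [hs_def, ← Real.rpow_natCast, ← Real.rpow_mul hr_pos.le, show (-(1/6) : ℝ) * (2 : ℕ) =
      -(1/3) by norm_num, Real.div_rpow hrf0.le hr00.le,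
      mul_div_cancel₀ _ (Real.rpow_pos_of_pos hr00 _).ne']
  have hφc : HasCompactSupport φ := by
    refine Metric.isCompact_of_isClosed_isBounded isClosed_closure ?_
    refine (Bornology.IsBounded.subset ?_ hsupp).closure
    exact (hbd.subset fun x hx => hx.1).smul₀ s
  obtain ⟨δ, hδ, L, hL, henergy⟩ := exists_abs_We_le μ hrf0 hr00 hs hr hclt hsr hs2
  set l := rf / r0 - 1
  have hG := hlip.comp_smul ⟨s, hs.le⟩
  obtain ⟨K₀, B₀, hK₀, hB₀⟩ := exists_lipschitz_shearField_comp hG hclt (fun x => hgrad _) s 0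
  obtain ⟨K₁, B₁, hK₁, hB₁⟩ := exists_lipschitz_shearField_comp hG hclt (fun x => hgrad _) s 1
  obtain ⟨M₀, hM₀, hreg₀⟩ := exists_isRegularization hK₀ hB₀
  obtain ⟨M₁, hM₁, hreg₁⟩ := exists_isRegularization hK₁ hB₁
  obtain ⟨M₂, hM₂, hreg₂⟩ := exists_mollification_C11 hφ hφc hlip
  set V₀ : (Fin 2 → ℝ) → ℝ := fun x => shearField s l 0 (grad2 φ (s • x))
  set V₁ : (Fin 2 → ℝ) → ℝ := fun x => shearField s l 1 (grad2 φ (s • x))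
  set M : ℝ := M₀ + M₁ + M₂ + K + K₀ + K₁ with hM_def
  have hKs : 0 ≤ (K : ℝ) ∧ 0 ≤ (K₀ : ℝ) ∧ 0 ≤ (K₁ : ℝ) := ⟨K.2, K₀.2, K₁.2⟩
  have hM : 0 < M := by linarith [hKs.1, hKs.2.1, hKs.2.2]
  have hV₀ : ∀ a b, |V₀ a - V₀ b| ≤ M * dist a b := fun a b =>
    (hK₀.dist_le_mul a b).trans (mul_le_mul_of_nonneg_right (by linarith) dist_nonneg)
  have hV₁ : ∀ a b, |V₁ a - V₁ b| ≤ M * dist a b := fun a b =>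
    (hK₁.dist_le_mul a b).trans (mul_le_mul_of_nonneg_right (by linarith) dist_nonneg)
  have hgφ : ∀ a b i, |grad2 φ a i - grad2 φ b i| ≤ M * dist a b := fun a b i =>
    (dist_le_pi_dist (grad2 φ a) (grad2 φ b) i).trans ((hlip.dist_le_mul a b).trans
      (mul_le_mul_of_nonneg_right (by linarith) dist_nonneg))
  obtain ⟨R, hR, hωR⟩ := hbd.exists_pos_norm_le
  set A : ℝ := 10 * M ^ 2 + 14 * M + τ with hA_def
  have hA : 0 < A := by positivity
  refine ⟨3 * M + L * A ^ 2 * (4 * R ^ 2), by positivity,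
    min 1 (min (1 / (16 * M)) (δ / A)), by positivity, fun h hh hh0 => ?_⟩
  have hh1 : h ≤ 1 := (hh0.trans_le (min_le_left _ _)).le
  have hMh : M * h ≤ 1 / 16 := by
    have := (hh0.trans_le ((min_le_right _ _).trans (min_le_left _ _))).le
    rw [le_div_iff₀ (by positivity)] at this
    linarith
  have hAh : A * h < δ := by
    have := hh0.trans_le ((min_le_right _ _).trans (min_le_right _ _))
    rw [lt_div_iff₀ hA] at this
    linarith
  obtain ⟨v₀, hv₀⟩ := hreg₀ h hh hh1
  obtain ⟨v₁, hv₁⟩ := hreg₁ h hh hh1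
  obtain ⟨ψ, hψ, hψ0, hψ1⟩ := hreg₂ h hh
  replace hv₀ : IsRegularization V₀ M h v₀ := hv₀.mono hh (by linarith)
  replace hv₁ : IsRegularization V₁ M h v₁ := hv₁.mono hh (by linarith)
  have hM₂M : M₂ * h ≤ M * h := mul_le_mul_of_nonneg_right (by linarith) hh.le
  replace hψ0 : ∀ x, |ψ x - φ x| ≤ M * h := fun x => (hψ0 x).trans hM₂M
  replace hψ1 : ∀ x i, |grad2 ψ x i - grad2 φ x i| ≤ M * h := fun x i => (hψ1 x i).trans hM₂M
  have hthin : ∀ x : Fin 3 → ℝ, |x 2| ≤ h / 2 → M * |x 2| ≤ 1 / 32 := fun x hx => by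
    have := mul_le_mul_of_nonneg_left hx hM.le
    linarith
  have hthin' : ∀ x : Fin 3 → ℝ, |x 2| ≤ h / 2 → M * |x 2| ≤ 1 / 16 := fun x hx =>
    (hthin x hx).trans (by norm_num)
  have hMh' : M * h ≤ 1 / 8 := hMh.trans (by norm_num)
  have hslab : ∀ x ∈ slab ω h, |x 2| ≤ h / 2 := fun x hx =>
    closure_slab_subset ω h (subset_closure hx)
  refine ⟨liftSurf s ψ, sheetMap s ψ v₀ v₁,
    ⟨Set.univ, isOpen_univ, Set.subset_univ _, (contDiff_liftSurf hψ).contDiffOn⟩,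
    ⟨{x | M * |x 2| < 1 / 16}, isOpen_lt (by fun_prop) continuous_const, ?_, ?_⟩,
    fun xt _ => sheetMap_emb s ψ v₀ v₁ xt, ?_, ?_, ?_⟩
  · intro x hx
    exact (hthin x (closure_slab_subset ω h hx)).trans_lt (by norm_num)
  · exact fun x hx =>
      (contDiffAt_sheetMap hψ hM.le hv₀ hv₁ (le_of_lt hx)).contDiffWithinAt
  · intro xt _
    rw [hy]
    refine (sqrt_add_sqrt_liftSurf_le (hψ.of_le (by norm_num)) hφ hs.le hs1 hψ0 hψ1 xt).trans ?_
    have : 0 ≤ L * A ^ 2 * (4 * R ^ 2) * h := by positivity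
    linarith
  · exact fun x hx => det_jac3_sheetMap hs.ne' hψ hM.le hv₀ hv₁ (hthin' x (hslab x hx))
  · intro N0 _ hN0
    have hvol := volume_slab_le hR hωR hh
    have hbound : ∀ᵐ x ∂(volume.restrict (slab ω h)),
        ‖We μ rf r0 (jac3 (sheetMap s ψ v₀ v₁) x)
          (nvec ((jac3 (sheetMap s ψ v₀ v₁) x).mulVec (N0 x))) (N0 x)‖ ≤ L * (A * h) ^ 2 := by
      filter_upwards [hN0, ae_restrict_mem (isOpen_slab hω h).measurableSet] with x hx hxs
      have hx2 := hslab x hxs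
      have hdet := det_jac3_sheetMap hs.ne' hψ hM.le hv₀ hv₁ (hthin' x hx2)
      have hw2 : |shear 1 v₁ x 2| ≤ h := (abs_shear_two_le 1 v₁ x).trans (by linarith)
      have hd1 : dist (shear 1 v₁ x) x ≤ (2 * M + 3) * h :=
        dist_shear_le hv₁.abs_le (hx2.trans (by linarith))
      have hd0 : dist (shear 0 v₀ (shear 1 v₁ x)) (shear 1 v₁ x) ≤ (2 * M + 3) * h :=
        dist_shear_le hv₀.abs_le hw2
      have hle : (10 * M ^ 2 + 14 * M) * h ≤ A * h :=
        mul_le_mul_of_nonneg_right (by linarith) hh.le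
      have hxx : dist x x ≤ (2 * M + 3) * h := by rw [dist_self]; positivity
      rw [jac3_sheetMap hψ hM.le hv₀ hv₁ (hthin' x hx2)] at hdet ⊢
      refine henergy (grad2 φ (s • proj2 x)) (hgrad _) _ _ _ _ _ (by positivity) hAh
        (fun k j => ?_) (fun k j => ?_) (fun k j => ?_) (fun i => ?_) hx.1 hdet
      · refine (abs_liftJac_sheet_sub_le hM hh hs.le hs1 hψ1 hgφ ?_ k j).trans hle
        linarith [dist_triangle (shear 0 v₀ (shear 1 v₁ x)) (shear 1 v₁ x) x]
      · exact (abs_jac3_shear_sub_field_le hM hh hv₀ hV₀ hMh' hw2 hd1 k j).trans hle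
      · exact (abs_jac3_shear_sub_field_le hM hh hv₁ hV₁ hMh' (hx2.trans (by linarith)) hxx
          k j).trans hle
      · have h1 : (N0 x i - n0 (proj2 x) i) ^ 2 ≤ (τ * h) ^ 2 :=
          (Finset.single_le_sum (f := fun i => (N0 x i - n0 (proj2 x) i) ^ 2)
            (fun _ _ => sq_nonneg _) (Finset.mem_univ i)).trans hx.2
        have h2 := abs_le_of_sq_le_sq h1 (by positivity)
        rw [hn0] at h2
        exact h2.trans (mul_le_mul_of_nonneg_right
          (le_add_of_nonneg_left (by positivity)) hh.le)
    have hint := norm_setIntegral_le_of_norm_le_const_ae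
      (hvol.trans_lt ENNReal.ofReal_lt_top) hbound
    have hvr : volume.real (slab ω h) ≤ 4 * R ^ 2 * h :=
      ENNReal.toReal_le_of_le_ofReal (by positivity) hvol
    calc _ ≤ L * (A * h) ^ 2 * volume.real (slab ω h) := (le_abs_self _).trans hint
      _ ≤ L * (A * h) ^ 2 * (4 * R ^ 2 * h) := by gcongr
      _ = L * A ^ 2 * (4 * R ^ 2) * h ^ 3 := by ring
      _ ≤ _ := by gcongr; linarith
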